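/- arXiv:2102.05128 — 2 statements merged into one kernel-verified Lean document; each statement's English description precedes it below -/
import Mathlib

section
/- Let γ ⊂ ℙ² be an irreducible conic and let ℓ₁,…,ℓ_r, m₁,…,m_s be pairwise distinct lines all tangent to γ, with r ≥ s ≥ 2. Let X = 𝕊(ℓ₁,…,ℓ_r) and Y = 𝕊(m₁,…,m_s) be the corresponding contact star configurations on γ. Then X ∪ Y is a complete intersection of some type (a,b) if and only if s = r or s = r−1. -/
open MvPolynomial

noncomputable section

abbrev P2 : Type := Projectivization ℂ (Fin 3 → ℂ)

/-- A line in `ℙ²`: the zero locus of a nonzero linear form. -/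
def IsLine (L : Set P2) : Prop :=
  ∃ a : Fin 3 → ℂ, a ≠ 0 ∧ L = {p : P2 | (∑ i, a i * p.rep i) = 0}

/-- An irreducible conic in `ℙ²`: the zero locus of an irreducible homogeneous quadratic form. -/
def IsIrredConic (γ : Set P2) : Prop :=
  ∃ q : MvPolynomial (Fin 3) ℂ, q.IsHomogeneous 2 ∧ Irreducible q ∧
    γ = {p : P2 | eval p.rep q = 0}

/-- `L` is tangent to `γ` : their intersection is a single point. -/
def IsTangent (L γ : Set P2) : Prop := ∃ p : P2, L ∩ γ = {p}

/-- The star configuration defined by a family of lines: the set of points lying on at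
least two of the lines. -/
def starConfig {r : ℕ} (L : Fin r → Set P2) : Set P2 :=
  {p : P2 | ∃ i j : Fin r, i ≠ j ∧ p ∈ L i ∧ p ∈ L j}

/-- A family of lines meets properly: they are distinct lines, no three concurrent. -/
def MeetsProperly {r : ℕ} (L : Fin r → Set P2) : Prop :=
  (∀ i, IsLine (L i)) ∧ Function.Injective L ∧
    ∀ (p : P2) (i j k : Fin r), p ∈ L i → p ∈ L j → p ∈ L k → i = j ∨ i = k ∨ j = k

/-- `W` is a complete intersection of type `(a,b)`. -/
def IsCI (W : Set P2) (a b : ℕ) : Prop :=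
  ∃ F G : MvPolynomial (Fin 3) ℂ, F ≠ 0 ∧ G ≠ 0 ∧
    F.IsHomogeneous a ∧ G.IsHomogeneous b ∧
    {p : P2 | eval p.rep F = 0 ∧ eval p.rep G = 0} = W ∧ W.ncard = a * b

/-- The `ℂ`-submodule of polynomials vanishing at every point of `W`. -/
def vanishingSubmodule (W : Set P2) : Submodule ℂ (MvPolynomial (Fin 3) ℂ) where
  carrier := {F : MvPolynomial (Fin 3) ℂ | ∀ p ∈ W, eval p.rep F = 0}
  add_mem' := by
    intro a b ha hb p hp
    simp only [map_add, ha p hp, hb p hp, add_zero]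
  zero_mem' := by
    intro p hp
    simp
  smul_mem' := by
    intro c F hF p hp
    simp only [smul_eval, hF p hp, mul_zero]

/-- The degree-`d` graded component of the vanishing ideal of `W`. -/
def idealComp (W : Set P2) (d : ℕ) : Submodule ℂ (MvPolynomial (Fin 3) ℂ) :=
  homogeneousSubmodule (Fin 3) ℂ d ⊓ vanishingSubmodule W

/-- The Hilbert function of `W ⊆ ℙ²`. -/
def HF (W : Set P2) (d : ℕ) : ℤ :=
  (Module.finrank ℂ ↥(homogeneousSubmodule (Fin 3) ℂ d) : ℤ) -
    (Module.finrank ℂ ↥(idealComp W d) : ℤ)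

/-- The h-vector of `W ⊆ ℙ²`. -/
def hvec (W : Set P2) : ℕ → ℤ
  | 0 => HF W 0
  | d + 1 => HF W (d + 1) - HF W d

/-- The (affine cone) ideal of a point of `ℙ²`; its powers cut out fat points. -/
def pointIdeal (p : P2) : Ideal (MvPolynomial (Fin 3) ℂ) := RingHom.ker (eval p.rep)

/-- The degree-`d` graded component of a homogeneous ideal `I`. -/
def idealCompI (I : Ideal (MvPolynomial (Fin 3) ℂ)) (d : ℕ) :
    Submodule ℂ (MvPolynomial (Fin 3) ℂ) :=
  homogeneousSubmodule (Fin 3) ℂ d ⊓ Submodule.restrictScalars ℂ I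

/-- The Hilbert function of `S/I`. -/
def HFI (I : Ideal (MvPolynomial (Fin 3) ℂ)) (d : ℕ) : ℤ :=
  (Module.finrank ℂ ↥(homogeneousSubmodule (Fin 3) ℂ d) : ℤ) -
    (Module.finrank ℂ ↥(idealCompI I d) : ℤ)

/-- The h-vector of `S/I`. -/
def hvecI (I : Ideal (MvPolynomial (Fin 3) ℂ)) : ℕ → ℤ
  | 0 => HFI I 0
  | d + 1 => HFI I (d + 1) - HFI I d

/-- The Hadamard-product relation: `R = P ⋆ Q`. -/
def hadRel (P Q R : P2) : Prop :=
  ∃ (u v : Fin 3 → ℂ) (hu : u ≠ 0) (hv : v ≠ 0) (huv : (fun i => u i * v i) ≠ 0),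
    Projectivization.mk ℂ u hu = P ∧ Projectivization.mk ℂ v hv = Q ∧
      Projectivization.mk ℂ (fun i => u i * v i) huv = R

/-- `Δ₀`: points of `ℙ²` with at most one nonzero coordinate. -/
def Δ₀ : Set P2 := {p : P2 | ∃ i : Fin 3, ∀ j : Fin 3, j ≠ i → p.rep j = 0}



/-- The alternating form on `ℂ²`. -/
def bracket (u w : ℂ × ℂ) : ℂ := u.1 * w.2 - u.2 * w.1

/-- The coefficient vector of the product of the two binary linear forms `u` and `v`. -/
def symProd (u v : ℂ × ℂ) : Fin 3 → ℂ := ![u.1 * v.1, u.1 * v.2 + u.2 * v.1, u.2 * v.2]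

/-- In the coordinates `T`, the set `L` is the line tangent to the discriminant conic
at `symProd w w`. -/
def IsTangentAt (T : (Fin 3 → ℂ) ≃ₗ[ℂ] (Fin 3 → ℂ)) (L : Set P2) (w : ℂ × ℂ) : Prop :=
  ∀ p : P2, p ∈ L ↔
    T p.rep 0 * w.2 ^ 2 - T p.rep 1 * (w.1 * w.2) + T p.rep 2 * w.1 ^ 2 = 0

lemma IsHomogeneous_eval_smul {σ : Type*} {F : MvPolynomial σ ℂ} {n : ℕ}
    (hF : F.IsHomogeneous n) (c : ℂ) (x : σ → ℂ) : eval (c • x) F = c ^ n * eval x F := by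
  rw [eval_eq, eval_eq, Finset.mul_sum]
  refine Finset.sum_congr rfl fun d hd => ?_
  simp only [Pi.smul_apply, smul_eq_mul, mul_pow, Finset.prod_mul_distrib]
  rw [Finset.prod_pow_eq_pow_sum, hF.degree_eq_sum_deg_support hd]
  ring

/-- The polynomial of a linear functional. -/
def linPoly (f : (Fin 3 → ℂ) →ₗ[ℂ] ℂ) : MvPolynomial (Fin 3) ℂ :=
  ∑ i, C (f (Pi.single i 1)) * X i

lemma eval_linPoly (f : (Fin 3 → ℂ) →ₗ[ℂ] ℂ) (x : Fin 3 → ℂ) : eval x (linPoly f) = f x := by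
  conv_rhs => rw [← LinearMap.sum_single_apply (fun _ : Fin 3 => ℂ) x]
  rw [linPoly, map_sum, map_sum]
  refine Finset.sum_congr rfl fun i _ => ?_
  have : Pi.single i (x i) = x i • (Pi.single i (1 : ℂ) : Fin 3 → ℂ) := by
    rw [← Pi.single_smul, smul_eq_mul, mul_one]
  simp [this, mul_comm]

lemma isHomogeneous_linPoly (f : (Fin 3 → ℂ) →ₗ[ℂ] ℂ) : (linPoly f).IsHomogeneous 1 :=
  IsHomogeneous.sum _ _ _ fun i _ => isHomogeneous_C_mul_X _ i

lemma exists_linear_of_isHomogeneous_one {F : MvPolynomial (Fin 3) ℂ} (hF : F.IsHomogeneous 1) :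
    ∃ f : (Fin 3 → ℂ) →ₗ[ℂ] ℂ, ∀ x, f x = eval x F := by
  have h : F ∈ homogeneousSubmodule (Fin 3) ℂ 1 := hF
  rw [homogeneousSubmodule_one_eq_span_X] at h
  clear hF
  induction h using Submodule.span_induction with
  | mem G hG =>
    obtain ⟨i, rfl⟩ := hG
    exact ⟨LinearMap.proj i, fun x => by simp⟩
  | zero => exact ⟨0, fun x => by simp⟩
  | add G H _ _ hG hH =>
    obtain ⟨f, hf⟩ := hG
    obtain ⟨g, hg⟩ := hH
    exact ⟨f + g, fun x => by simp [hf, hg]⟩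
  | smul c G _ hG =>
    obtain ⟨f, hf⟩ := hG
    exact ⟨c • f, fun x => by simp [hf]⟩

lemma exists_quadraticForm {q : MvPolynomial (Fin 3) ℂ} (hq : q.IsHomogeneous 2) :
    ∃ Q : QuadraticForm ℂ (Fin 3 → ℂ), ∀ x, Q x = eval x q := by
  have h : q ∈ homogeneousSubmodule (Fin 3) ℂ 1 * homogeneousSubmodule (Fin 3) ℂ 1 := by
    rw [← pow_two, homogeneousSubmodule_one_pow]; exact hq
  clear hq
  induction h using Submodule.mul_induction_on' with
  | mem_mul_mem m hm n hn =>
    obtain ⟨f, hf⟩ := exists_linear_of_isHomogeneous_one hm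
    obtain ⟨g, hg⟩ := exists_linear_of_isHomogeneous_one hn
    exact ⟨QuadraticMap.linMulLin f g, fun x => by simp [hf, hg]⟩
  | add x hx y hy h1 h2 =>
    obtain ⟨P, hP⟩ := h1
    obtain ⟨Q, hQ⟩ := h2
    exact ⟨P + Q, fun z => by simp [hP, hQ]⟩

lemma exists_ne_zero_diagonal {q : MvPolynomial (Fin 3) ℂ} (hq : q.IsHomogeneous 2)
    (hirr : Irreducible q) :
    ∃ (w : Fin 3 → ℂ) (e : (Fin 3 → ℂ) ≃ₗ[ℂ] (Fin 3 → ℂ)), (∀ i, w i ≠ 0) ∧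
      ∀ x, eval x q = ∑ i, (w i * e x i) ^ 2 := by
  obtain ⟨Q, hQ⟩ := exists_quadraticForm hq
  obtain ⟨w, ⟨e⟩⟩ := QuadraticForm.equivalent_weightedSumSquares Q
  have h3 : Module.finrank ℂ (Fin 3 → ℂ) = 3 := by simp
  generalize Module.finrank ℂ (Fin 3 → ℂ) = n at h3 w e
  subst h3
  choose v hv using fun i => IsAlgClosed.exists_pow_nat_eq (w i) (n := 2) two_pos
  have hsum : ∀ x, eval x q = ∑ i, (v i * e x i) ^ 2 := by
    intro x
    rw [← hQ, ← e.map_app, QuadraticMap.weightedSumSquares_apply]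
    refine Finset.sum_congr rfl fun i _ => ?_
    rw [← hv]
    simp; ring
  refine ⟨v, e.toLinearEquiv, fun k hk => ?_, hsum⟩
  have key : ∃ i j : Fin 3, ∀ x, eval x q = (v i * e x i) ^ 2 + (v j * e x j) ^ 2 := by
    fin_cases k
    · exact ⟨1, 2, fun x => by simp at hk; simp [hsum x, Fin.sum_univ_three, hk]⟩
    · exact ⟨0, 2, fun x => by simp at hk; simp [hsum x, Fin.sum_univ_three, hk]⟩
    · exact ⟨0, 1, fun x => by simp at hk; simp [hsum x, Fin.sum_univ_three, hk]⟩
  obtain ⟨i, j, hij⟩ := key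
  let E : Fin 3 → ((Fin 3 → ℂ) →ₗ[ℂ] ℂ) :=
    fun i => v i • (LinearMap.proj i ∘ₗ e.toLinearEquiv.toLinearMap)
  have hfac : q = linPoly (E i + Complex.I • E j) * linPoly (E i - Complex.I • E j) := by
    refine MvPolynomial.funext fun x => ?_
    rw [map_mul, eval_linPoly, eval_linPoly, hij]
    simp [E]
    ring_nf
    simp [Complex.I_sq]
  have hunit : ∀ f, ¬ IsUnit (linPoly f) := fun f hf => by
    have := hf.map (eval (0 : Fin 3 → ℂ))
    rw [eval_linPoly, map_zero] at this
    exact not_isUnit_zero this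
  rcases hirr.isUnit_or_isUnit hfac with h | h
  · exact hunit _ h
  · exact hunit _ h

lemma exists_discriminant_coordinates {γ : Set P2} (hγ : IsIrredConic γ) :
    ∃ T : (Fin 3 → ℂ) ≃ₗ[ℂ] (Fin 3 → ℂ),
      ∀ p : P2, p ∈ γ ↔ T p.rep 1 ^ 2 = 4 * (T p.rep 0 * T p.rep 2) := by
  obtain ⟨q, hq, hirr, rfl⟩ := hγ
  obtain ⟨w, e, hw, hsum⟩ := exists_ne_zero_diagonal hq hirr
  let f : (Fin 3 → ℂ) →ₗ[ℂ] (Fin 3 → ℂ) :=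
    { toFun := fun x => ![w 0 * x 0 + Complex.I * (w 1 * x 1), 2 * (w 2 * x 2),
        -(w 0 * x 0 - Complex.I * (w 1 * x 1))]
      map_add' := fun x y => by ext i; fin_cases i <;> simp <;> ring
      map_smul' := fun c x => by ext i; fin_cases i <;> simp <;> ring }
  have hf : Function.Injective f := by
    rw [← LinearMap.ker_eq_bot, LinearMap.ker_eq_bot']
    intro x hx
    have h0 : w 0 * x 0 + Complex.I * (w 1 * x 1) = 0 := congrFun hx 0
    have h1 : 2 * (w 2 * x 2) = 0 := congrFun hx 1
    have h2 : -(w 0 * x 0 - Complex.I * (w 1 * x 1)) = 0 := congrFun hx 2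
    have h3 : w 0 * x 0 = 0 := by linear_combination (h0 - h2) / 2
    have h4 : w 1 * x 1 = 0 := by
      have : Complex.I * (w 1 * x 1) = 0 := by linear_combination (h0 + h2) / 2
      simpa using this
    have h5 : w 2 * x 2 = 0 := by linear_combination h1 / 2
    ext i
    fin_cases i
    · simpa [hw] using h3
    · simpa [hw] using h4
    · simpa [hw] using h5
  refine ⟨e.trans (LinearEquiv.ofInjectiveEndo f hf), fun p => ?_⟩
  have hI := Complex.I_sq
  have h0 : ∀ y, f y 0 = w 0 * y 0 + Complex.I * (w 1 * y 1) := fun y => rfl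
  have h1 : ∀ y, f y 1 = 2 * (w 2 * y 2) := fun y => rfl
  have h2 : ∀ y, f y 2 = -(w 0 * y 0 - Complex.I * (w 1 * y 1)) := fun y => rfl
  simp only [Set.mem_ofPred_eq, hsum, Fin.sum_univ_three, LinearEquiv.trans_apply,
    LinearEquiv.coe_ofInjectiveEndo, h0, h1, h2]
  constructor <;> intro h
  · linear_combination 4 * h + 4 * (w 1 * e p.rep 1) ^ 2 * (-hI)
  · linear_combination h / 4 + (w 1 * e p.rep 1) ^ 2 * (hI)

lemma bracket_swap (u w : ℂ × ℂ) : bracket w u = -bracket u w := by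
  simp only [bracket]; ring

lemma exists_smul_of_bracket_eq_zero {u w : ℂ × ℂ} (hu : u ≠ 0) (h : bracket u w = 0) :
    ∃ k : ℂ, w = k • u := by
  simp only [bracket] at h
  by_cases h1 : u.1 = 0
  · have h2 : u.2 ≠ 0 := fun h2 => hu (Prod.ext h1 h2)
    refine ⟨w.2 / u.2, Prod.ext ?_ ?_⟩
    · simp only [Prod.smul_fst, smul_eq_mul, h1, mul_zero]
      simpa [h1, h2] using h
    · simp [h2]
  · refine ⟨w.1 / u.1, Prod.ext ?_ ?_⟩
    · simp [h1]
    · simp only [Prod.smul_snd, smul_eq_mul]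
      field_simp
      linear_combination h

lemma bracket_smul_left (k : ℂ) (u w : ℂ × ℂ) : bracket (k • u) w = k * bracket u w := by
  simp [bracket]; ring

lemma bracket_self (u : ℂ × ℂ) : bracket u u = 0 := by
  simp [bracket, mul_comm]

lemma bracket_eq_zero_trans {u v a : ℂ × ℂ} (ha : a ≠ 0) (hu : bracket u a = 0)
    (hv : bracket v a = 0) : bracket u v = 0 := by
  obtain ⟨k, rfl⟩ := exists_smul_of_bracket_eq_zero ha (by rw [bracket_swap, hu, neg_zero])
  rw [bracket_smul_left, bracket_swap, hv, neg_zero, mul_zero]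

lemma exists_bracket_ne_zero {u : ℂ × ℂ} (hu : u ≠ 0) : ∃ e, bracket u e ≠ 0 := by
  by_contra! h
  refine hu (Prod.ext ?_ ?_)
  · simpa [bracket] using h (0, 1)
  · simpa [bracket] using h (1, 0)

lemma ne_zero_of_bracket_ne_zero {u w : ℂ × ℂ} (h : bracket u w ≠ 0) : u ≠ 0 := by
  rintro rfl
  simp [bracket] at h

lemma exists_eq_symProd (y : Fin 3 → ℂ) : ∃ u v, y = symProd u v := by
  by_cases h0 : y 0 = 0
  · refine ⟨(0, 1), (y 1, y 2), ?_⟩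
    ext i
    fin_cases i <;> simp [symProd, h0]
  · obtain ⟨z, hz⟩ := IsAlgClosed.exists_pow_nat_eq (y 1 ^ 2 - 4 * (y 0 * y 2)) (n := 2) two_pos
    refine ⟨(1, (y 1 + z) / (2 * y 0)), (y 0, (y 1 - z) / 2), ?_⟩
    ext i
    fin_cases i
    · simp [symProd]
    · simp [symProd]
      field_simp
      ring
    · simp [symProd]
      field_simp
      linear_combination hz

lemma left_ne_zero_of_symProd {u v : ℂ × ℂ} (h : symProd u v ≠ 0) : u ≠ 0 := by
  rintro rfl
  refine h ?_
  ext i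
  fin_cases i <;> simp [symProd]

lemma symProd_comm (u v : ℂ × ℂ) : symProd u v = symProd v u := by
  ext i
  fin_cases i <;> simp [symProd] <;> ring

lemma symProd_smul_left (k : ℂ) (u v : ℂ × ℂ) : symProd (k • u) v = k • symProd u v := by
  ext i
  fin_cases i <;> simp [symProd] <;> ring

lemma symProd_ne_zero {u v : ℂ × ℂ} (hu : u ≠ 0) (hv : v ≠ 0) : symProd u v ≠ 0 := by
  intro h
  have h0 : u.1 * v.1 = 0 := congrFun h 0
  have h1 : u.1 * v.2 + u.2 * v.1 = 0 := congrFun h 1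
  have h2 : u.2 * v.2 = 0 := congrFun h 2
  rcases mul_eq_zero.mp h0 with h0 | h0 <;> rcases mul_eq_zero.mp h2 with h2 | h2
  · exact hu (Prod.ext h0 h2)
  · rw [h0, h2] at h1
    have : u.2 * v.1 = 0 := by linear_combination h1
    rcases mul_eq_zero.mp this with h | h
    · exact hu (Prod.ext h0 h)
    · exact hv (Prod.ext h h2)
  · rw [h0, h2] at h1
    have : u.1 * v.2 = 0 := by linear_combination h1
    rcases mul_eq_zero.mp this with h | h
    · exact hu (Prod.ext h h2)
    · exact hv (Prod.ext h0 h)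
  · exact hv (Prod.ext h0 h2)

/-- `symProd` as a linear map of its second argument. -/
def symProdLin (u : ℂ × ℂ) : ℂ × ℂ →ₗ[ℂ] (Fin 3 → ℂ) where
  toFun := symProd u
  map_add' x y := by
    ext i
    fin_cases i <;> simp [symProd] <;> ring
  map_smul' c x := by
    rw [symProd_comm, symProd_smul_left, symProd_comm]
    rfl

section Frame

variable (T : (Fin 3 → ℂ) ≃ₗ[ℂ] (Fin 3 → ℂ))

lemma exists_point {y : Fin 3 → ℂ} (hy : y ≠ 0) : ∃ p : P2, ∃ k : ℂ, k ≠ 0 ∧ T p.rep = k • y := by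
  have h : T.symm y ≠ 0 := by simpa using hy
  obtain ⟨k, hk⟩ := Projectivization.exists_smul_eq_mk_rep ℂ (T.symm y) h
  refine ⟨Projectivization.mk ℂ (T.symm y) h, k, k.ne_zero, ?_⟩
  rw [← hk, Units.smul_def, map_smul, LinearEquiv.apply_symm_apply]

lemma point_ext {p q : P2} {k : ℂ} (h : T p.rep = k • T q.rep) : p = q := by
  rw [← p.mk_rep, ← q.mk_rep, Projectivization.mk_eq_mk_iff']
  exact ⟨k, T.injective (by rw [map_smul, h])⟩

lemma exists_point_factors (p : P2) : ∃ u v, u ≠ 0 ∧ v ≠ 0 ∧ T p.rep = symProd u v := by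
  obtain ⟨u, v, h⟩ := exists_eq_symProd (T p.rep)
  have h0 : symProd u v ≠ 0 := by
    rw [← h]
    simpa using p.rep_nonzero
  refine ⟨u, v, left_ne_zero_of_symProd h0, ?_, h⟩
  rw [symProd_comm] at h0
  exact left_ne_zero_of_symProd h0

lemma exists_point_symProd {u v : ℂ × ℂ} (hu : u ≠ 0) (hv : v ≠ 0) :
    ∃ p : P2, ∃ k : ℂ, k ≠ 0 ∧ T p.rep = symProd (k • u) v := by
  obtain ⟨p, k, hk, h⟩ := exists_point T (symProd_ne_zero hu hv)
  exact ⟨p, k, hk, by rw [h, symProd_smul_left]⟩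

variable {T}

lemma IsTangentAt.mem_iff {L : Set P2} {w : ℂ × ℂ} (h : IsTangentAt T L w) {p : P2}
    {u v : ℂ × ℂ} (hp : T p.rep = symProd u v) :
    p ∈ L ↔ bracket u w = 0 ∨ bracket v w = 0 := by
  rw [h p, hp, ← mul_eq_zero]
  simp only [symProd, bracket, Matrix.cons_val_zero, Matrix.cons_val_one, Matrix.cons_val]
  constructor <;> intro h <;> linear_combination h

lemma IsTangentAt.bracket_ne_zero {L M : Set P2} {w z : ℂ × ℂ} (hw : w ≠ 0) (hz : z ≠ 0)
    (h : IsTangentAt T L w) (h' : IsTangentAt T M z) (hLM : L ≠ M) : bracket w z ≠ 0 := by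
  intro h0
  refine hLM (Set.ext fun p => ?_)
  obtain ⟨u, v, hu, hv, hp⟩ := exists_point_factors T p
  rw [h.mem_iff hp, h'.mem_iff hp]
  have h1 : bracket z w = 0 := by rw [bracket_swap, h0, neg_zero]
  have key : ∀ x, bracket x w = 0 ↔ bracket x z = 0 := fun x =>
    ⟨fun hx => bracket_eq_zero_trans hw hx h1, fun hx => bracket_eq_zero_trans hz hx h0⟩
  rw [key, key]

lemma exists_isTangentAt {γ L : Set P2}
    (hT : ∀ p : P2, p ∈ γ ↔ T p.rep 1 ^ 2 = 4 * (T p.rep 0 * T p.rep 2))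
    (hL : IsLine L) (hLγ : IsTangent L γ) : ∃ w, w ≠ 0 ∧ IsTangentAt T L w := by
  obtain ⟨a, ha, rfl⟩ := hL
  let f : (Fin 3 → ℂ) →ₗ[ℂ] ℂ := (∑ i, a i • LinearMap.proj i) ∘ₗ T.symm.toLinearMap
  have hf : ∀ x, f (T x) = ∑ i, a i * x i := fun x => by simp [f]
  obtain ⟨α, hα⟩ : ∃ α : Fin 3 → ℂ, ∀ y, f y = α 0 * y 0 + α 1 * y 1 + α 2 * y 2 := by
    refine ⟨fun i => f (Pi.single i 1), fun y => ?_⟩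
    rw [← eval_linPoly f y]
    simp [linPoly, Fin.sum_univ_three]
  obtain ⟨m, n, hmn⟩ := exists_eq_symProd ![α 0, 2 * α 1, α 2]
  have h0 : α 0 = m.1 * n.1 := congrFun hmn 0
  have h1 : 2 * α 1 = m.1 * n.2 + m.2 * n.1 := congrFun hmn 1
  have h2 : α 2 = m.2 * n.2 := congrFun hmn 2
  have hα0 : symProd m n ≠ 0 := by
    intro h
    rw [← hmn] at h
    have e0 : α 0 = 0 := congrFun h 0
    have e1 : 2 * α 1 = 0 := congrFun h 1
    have e2 : α 2 = 0 := congrFun h 2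
    have e1' : α 1 = 0 := by simpa using e1
    refine ha (funext fun i => ?_)
    have := hf (Pi.single i 1)
    rw [hα, e0, e1', e2] at this
    simpa [Pi.single_apply] using this.symm
  have hm := left_ne_zero_of_symProd hα0
  have hn := left_ne_zero_of_symProd (symProd_comm m n ▸ hα0)
  have hmem : ∀ z : ℂ × ℂ, z ≠ 0 → bracket z (-m.2, m.1) * bracket z (-n.2, n.1) = 0 →
      ∃ p ∈ {p : P2 | (∑ i, a i * p.rep i) = 0} ∩ γ, ∃ k : ℂ, k ≠ 0 ∧
        T p.rep = symProd (k • z) z := by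
    intro z hz h
    obtain ⟨p, k, hk, hp⟩ := exists_point_symProd T hz hz
    refine ⟨p, ⟨?_, ?_⟩, k, hk, hp⟩
    · rw [Set.mem_ofPred_eq, ← hf, hα, hp]
      simp only [bracket] at h
      simp [symProd]
      linear_combination k * h + k * z.1 ^ 2 * h0 + k * z.1 * z.2 * h1 + k * z.2 ^ 2 * h2
    · rw [hT, hp]
      simp [symProd]
      ring
  have hm' : ((-m.2, m.1) : ℂ × ℂ) ≠ 0 := fun h => hm (by simp at h; exact Prod.ext h.2 h.1)
  have hn' : ((-n.2, n.1) : ℂ × ℂ) ≠ 0 := fun h => hn (by simp at h; exact Prod.ext h.2 h.1)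
  obtain ⟨P, hP⟩ := hLγ
  obtain ⟨p, hp, k, hk, hpk⟩ := hmem _ hm' (by simp [bracket_self])
  obtain ⟨p', hp', k', hk', hpk'⟩ := hmem _ hn' (by simp [bracket_self])
  have hpp : p = p' := by
    rw [hP] at hp hp'
    exact hp.trans hp'.symm
  rw [← hpp, hpk] at hpk'
  have e0 : k * m.2 * m.2 = k' * n.2 * n.2 := by simpa [symProd] using congrFun hpk' 0
  have e1 : -(k * m.2 * m.1) + -(k * m.1 * m.2) = -(k' * n.2 * n.1) + -(k' * n.1 * n.2) := by
    simpa [symProd] using congrFun hpk' 1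
  have e2 : k * m.1 * m.1 = k' * n.1 * n.1 := by simpa [symProd] using congrFun hpk' 2
  have hbr : bracket m n = 0 := by
    have : k * bracket m n ^ 2 = 0 := by
      simp only [bracket]
      linear_combination e0 * n.1 ^ 2 + e1 * n.1 * n.2 + e2 * n.2 ^ 2
    simpa [hk] using this
  obtain ⟨c, rfl⟩ := exists_smul_of_bracket_eq_zero hm hbr
  have hc : c ≠ 0 := by
    rintro rfl
    simp at hn
  refine ⟨(-m.2, m.1), hm', fun q => ?_⟩
  rw [Set.mem_ofPred_eq, ← hf, hα, h0, h2]
  have h1' : α 1 = m.1 * (c * m.2) := by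
    simp at h1
    linear_combination h1 / 2
  rw [h1']
  simp only [Prod.smul_fst, Prod.smul_snd, smul_eq_mul]
  constructor <;> intro h
  · refine (mul_eq_zero.mp (?_ : c * _ = 0)).resolve_left hc
    linear_combination h
  · linear_combination c * h

end Frame

lemma bracket_eq_zero_of_three {u v a b c : ℂ × ℂ} (hu : u ≠ 0) (hv : v ≠ 0)
    (ha : bracket u a = 0 ∨ bracket v a = 0) (hb : bracket u b = 0 ∨ bracket v b = 0)
    (hc : bracket u c = 0 ∨ bracket v c = 0) :
    bracket a b = 0 ∨ bracket a c = 0 ∨ bracket b c = 0 := by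
  have key : ∀ {x a b : ℂ × ℂ}, x ≠ 0 → bracket x a = 0 → bracket x b = 0 → bracket a b = 0 :=
    fun hx h1 h2 => bracket_eq_zero_trans hx (by rw [bracket_swap, h1, neg_zero])
      (by rw [bracket_swap, h2, neg_zero])
  rcases ha with ha | ha <;> rcases hb with hb | hb <;> rcases hc with hc | hc
  · exact .inl (key hu ha hb)
  · exact .inl (key hu ha hb)
  · exact .inr (.inl (key hu ha hc))
  · exact .inr (.inr (key hv hb hc))
  · exact .inr (.inr (key hu hb hc))
  · exact .inr (.inl (key hv ha hc))
  · exact .inl (key hv ha hb)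
  · exact .inl (key hv ha hb)

section Configurations

variable {T : (Fin 3 → ℂ) ≃ₗ[ℂ] (Fin 3 → ℂ)}

lemma point_mem_of_bracket_eq_zero {L M : Set P2} {w z : ℂ × ℂ} (hL : IsTangentAt T L w)
    (hM : IsTangentAt T M z) {p : P2} {u v : ℂ × ℂ} (hp : T p.rep = symProd u v)
    (hu : bracket u w = 0) (hv : bracket v z = 0) : p ∈ L ∧ p ∈ M :=
  ⟨(hL.mem_iff hp).mpr (.inl hu), (hM.mem_iff hp).mpr (.inr hv)⟩

lemma IsTangentAt.eq_smul_symProd {L M : Set P2} {w z : ℂ × ℂ} (hL : IsTangentAt T L w)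
    (hM : IsTangentAt T M z) (hwz : bracket w z ≠ 0) {p : P2} (hpL : p ∈ L) (hpM : p ∈ M) :
    ∃ k : ℂ, k ≠ 0 ∧ T p.rep = symProd (k • w) z := by
  obtain ⟨u, v, hu, hv, hp⟩ := exists_point_factors T p
  have aux : ∀ u v : ℂ × ℂ, u ≠ 0 → v ≠ 0 → T p.rep = symProd u v → bracket u w = 0 →
      bracket v z = 0 → ∃ k : ℂ, k ≠ 0 ∧ T p.rep = symProd (k • w) z := by
    intro u v hu hv hp h1 h2
    have hw := ne_zero_of_bracket_ne_zero hwz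
    have hz : z ≠ 0 := by
      rintro rfl
      simp [bracket] at hwz
    obtain ⟨c, rfl⟩ := exists_smul_of_bracket_eq_zero hw (by rw [bracket_swap, h1, neg_zero])
    obtain ⟨d, rfl⟩ := exists_smul_of_bracket_eq_zero hz (by rw [bracket_swap, h2, neg_zero])
    refine ⟨d * c, mul_ne_zero (fun h => by simp [h] at hv) (fun h => by simp [h] at hu), ?_⟩
    rw [hp, symProd_comm, symProd_smul_left, symProd_comm, ← symProd_smul_left, smul_smul]
  have hne : ∀ {x : ℂ × ℂ}, x ≠ 0 → bracket x w = 0 → bracket x z = 0 → False :=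
    fun hx h1 h2 => hwz (bracket_eq_zero_trans hx (by rw [bracket_swap, h1, neg_zero])
      (by rw [bracket_swap, h2, neg_zero]))
  rcases (hL.mem_iff hp).mp hpL with h1 | h1 <;> rcases (hM.mem_iff hp).mp hpM with h2 | h2
  · exact (hne hu h1 h2).elim
  · exact aux u v hu hv hp h1 h2
  · exact aux v u hv hu (by rw [hp, symProd_comm]) h1 h2
  · exact (hne hv h1 h2).elim

lemma ncard_starConfig {r : ℕ} {L : Fin r → Set P2} {a : Fin r → ℂ × ℂ}
    (hL : ∀ i, IsTangentAt T (L i) (a i)) (ha : ∀ i, a i ≠ 0)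
    (hind : ∀ i j, i ≠ j → bracket (a i) (a j) ≠ 0) : (starConfig L).ncard = r.choose 2 := by
  classical
  have hcard : ((Finset.powersetCard 2 (Finset.univ : Finset (Fin r)) : Finset _) :
      Set (Finset (Fin r))).ncard = r.choose 2 := by
    rw [Set.ncard_coe_finset, Finset.card_powersetCard, Finset.card_fin]
  rw [← hcard]
  have hfilter : ∀ p i j, i ≠ j → p ∈ L i → p ∈ L j →
      Finset.univ.filter (fun k => p ∈ L k) = {i, j} := by
    intro p i j hij hi hj
    ext k
    simp only [Finset.mem_filter, Finset.mem_univ, true_and, Finset.mem_insert,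
      Finset.mem_singleton]
    constructor
    · intro hk
      obtain ⟨u, v, hu, hv, hp⟩ := exists_point_factors T p
      rw [(hL _).mem_iff hp] at hi hj hk
      by_contra! hne
      rcases bracket_eq_zero_of_three hu hv hi hj hk with h | h | h
      · exact hind _ _ hij h
      · exact hind _ _ hne.1.symm h
      · exact hind _ _ hne.2.symm h
    · rintro (rfl | rfl) <;> assumption
  refine Set.BijOn.ncard_eq (f := fun p => Finset.univ.filter (fun k => p ∈ L k)) ⟨?_, ?_, ?_⟩
  · rintro p ⟨i, j, hij, hi, hj⟩
    simp only [Finset.mem_coe, Finset.mem_powersetCard, Finset.subset_univ, true_and]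
    rw [hfilter p i j hij hi hj, Finset.card_pair hij]
  · rintro p ⟨i, j, hij, hi, hj⟩ q - hpq
    have hq : ∀ k, p ∈ L k → q ∈ L k := fun k hk => by
      have : k ∈ Finset.univ.filter (fun k => p ∈ L k) := by simp [hk]
      rw [show Finset.univ.filter (fun k => p ∈ L k) = _ from hpq] at this
      simpa using this
    obtain ⟨k, -, h1⟩ := (hL i).eq_smul_symProd (hL j) (hind i j hij) hi hj
    obtain ⟨k', hk', h2⟩ := (hL i).eq_smul_symProd (hL j) (hind i j hij) (hq i hi) (hq j hj)
    refine point_ext T (k := k / k') ?_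
    rw [h1, h2, ← symProd_smul_left, smul_smul, div_mul_cancel₀ _ hk']
  · intro S hS
    simp only [Finset.mem_coe, Finset.mem_powersetCard, Finset.subset_univ, true_and] at hS
    obtain ⟨i, j, hij, rfl⟩ := Finset.card_eq_two.mp hS
    obtain ⟨p, k, hk, hp⟩ := exists_point_symProd T (ha i) (ha j)
    obtain ⟨hi, hj⟩ := point_mem_of_bracket_eq_zero (hL i) (hL j) hp
      (by rw [bracket_smul_left, bracket_self, mul_zero]) (bracket_self _)
    exact ⟨p, ⟨i, j, hij, hi, hj⟩, hfilter p i j hij hi hj⟩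

lemma disjoint_starConfig {r s : ℕ} {L : Fin r → Set P2} {M : Fin s → Set P2}
    {a : Fin r → ℂ × ℂ} {b : Fin s → ℂ × ℂ}
    (hL : ∀ i, IsTangentAt T (L i) (a i)) (hM : ∀ j, IsTangentAt T (M j) (b j))
    (hind : ∀ i j, i ≠ j → bracket (a i) (a j) ≠ 0) (hab : ∀ i j, bracket (a i) (b j) ≠ 0) :
    Disjoint (starConfig L) (starConfig M) := by
  rw [Set.disjoint_left]
  rintro p ⟨i, j, hij, hi, hj⟩ ⟨k, l, -, hk, -⟩
  obtain ⟨u, v, hu, hv, hp⟩ := exists_point_factors T p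
  rw [(hL _).mem_iff hp] at hi hj
  rw [(hM _).mem_iff hp] at hk
  rcases bracket_eq_zero_of_three hu hv hi hj hk with h | h | h
  · exact hind _ _ hij h
  · exact hab _ _ h
  · exact hab _ _ h

lemma finite_starConfig {r : ℕ} {L : Fin r → Set P2} {a : Fin r → ℂ × ℂ}
    (hL : ∀ i, IsTangentAt T (L i) (a i))
    (hind : ∀ i j, i ≠ j → bracket (a i) (a j) ≠ 0) : (starConfig L).Finite := by
  have : starConfig L ⊆ ⋃ i, ⋃ j, {p | i ≠ j ∧ p ∈ L i ∧ p ∈ L j} := by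
    rintro p ⟨i, j, h⟩
    exact Set.mem_iUnion.mpr ⟨i, Set.mem_iUnion.mpr ⟨j, h⟩⟩
  refine Set.Finite.subset (Set.finite_iUnion fun i => Set.finite_iUnion fun j => ?_) this
  refine Set.Subsingleton.finite ?_
  rintro p ⟨hij, hi, hj⟩ q ⟨-, hi', hj'⟩
  obtain ⟨k, -, h1⟩ := (hL i).eq_smul_symProd (hL j) (hind i j hij) hi hj
  obtain ⟨k', hk', h2⟩ := (hL i).eq_smul_symProd (hL j) (hind i j hij) hi' hj'
  refine point_ext T (k := k / k') ?_
  rw [h1, h2, ← symProd_smul_left, smul_smul, div_mul_cancel₀ _ hk']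

lemma ncard_starConfig_union {r s : ℕ} {L : Fin r → Set P2} {M : Fin s → Set P2}
    {a : Fin r → ℂ × ℂ} {b : Fin s → ℂ × ℂ}
    (hL : ∀ i, IsTangentAt T (L i) (a i)) (hM : ∀ j, IsTangentAt T (M j) (b j))
    (ha0 : ∀ i, a i ≠ 0) (hb0 : ∀ j, b j ≠ 0)
    (ha : ∀ i j, i ≠ j → bracket (a i) (a j) ≠ 0) (hb : ∀ i j, i ≠ j → bracket (b i) (b j) ≠ 0)
    (hab : ∀ i j, bracket (a i) (b j) ≠ 0) :
    (starConfig L ∪ starConfig M).ncard = r.choose 2 + s.choose 2 := by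
  rw [Set.ncard_union_eq (disjoint_starConfig hL hM ha hab) (finite_starConfig hL ha)
    (finite_starConfig hM hb), ncard_starConfig hL ha0 ha, ncard_starConfig hM hb0 hb]

end Configurations

lemma exists_bracket_ne_zero_of_finset (s : Finset (ℂ × ℂ)) (hs : ∀ w ∈ s, w ≠ 0) :
    ∃ e, ∀ w ∈ s, bracket w e ≠ 0 := by
  classical
  obtain ⟨c, hc⟩ := Infinite.exists_notMem_finset (s.image fun w => w.2 / w.1)
  refine ⟨(1, c), fun w hw h => ?_⟩
  simp only [bracket, mul_one] at h
  by_cases h1 : w.1 = 0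
  · exact hs w hw (Prod.ext h1 (by simpa [h1] using h))
  · refine hc (Finset.mem_image.mpr ⟨w, hw, ?_⟩)
    field_simp
    linear_combination -h

/-- A binary form of degree `n` with more than `n` distinct projective zeros vanishes. -/
lemma eval_eq_zero_of_card_lt {F : MvPolynomial (Fin 3) ℂ} {n : ℕ} (hF : F.IsHomogeneous n)
    (l : ℂ × ℂ →ₗ[ℂ] (Fin 3 → ℂ)) {ι : Type*} (s : Finset ι) (w : ι → ℂ × ℂ)
    (hw : ∀ i ∈ s, w i ≠ 0) (hind : ∀ i ∈ s, ∀ j ∈ s, i ≠ j → bracket (w i) (w j) ≠ 0)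
    (hzero : ∀ i ∈ s, eval (l (w i)) F = 0) (hcard : n < s.card) {v : ℂ × ℂ} (hv : v ≠ 0) :
    eval (l v) F = 0 := by
  classical
  obtain ⟨e, he⟩ := exists_bracket_ne_zero_of_finset (insert v (s.image w)) (by
    intro x hx
    rcases Finset.mem_insert.mp hx with rfl | hx
    · exact hv
    · obtain ⟨i, hi, rfl⟩ := Finset.mem_image.mp hx
      exact hw i hi)
  have hve : bracket v e ≠ 0 := he v (Finset.mem_insert_self _ _)
  have hwe : ∀ i ∈ s, bracket (w i) e ≠ 0 := fun i hi =>
    he _ (Finset.mem_insert_of_mem (Finset.mem_image_of_mem w hi))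
  let P : Polynomial ℂ :=
    aeval (fun i => Polynomial.C (l v i) + Polynomial.C (l e i) * Polynomial.X) F
  have hP : ∀ t, P.eval t = eval (l (v + t • e)) F := by
    intro t
    have : P.eval t = (Polynomial.evalRingHom t).comp
      (aeval (fun i => Polynomial.C (l v i) + Polynomial.C (l e i) * Polynomial.X)).toRingHom F :=
        rfl
    rw [this]
    congr 1
    refine MvPolynomial.ringHom_ext (fun r => ?_) (fun i => ?_)
    · simp only [AlgHom.toRingHom_eq_coe, RingHom.comp_apply, RingHom.coe_coe,
        MvPolynomial.algHom_C, Polynomial.algebraMap_eq, Polynomial.coe_evalRingHom,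
        Polynomial.eval_C, eval_C]
    · simp only [AlgHom.toRingHom_eq_coe, RingHom.comp_apply, RingHom.coe_coe, aeval_X,
        Polynomial.coe_evalRingHom, Polynomial.eval_mul, Polynomial.eval_C,
        Polynomial.eval_X, eval_X, map_add, map_smul, Pi.add_apply, Pi.smul_apply, smul_eq_mul,
        mul_comm]
  have hdeg : P.natDegree ≤ n := by
    have := MvPolynomial.aeval_natDegree_le F (m := n) (n := 1) hF.totalDegree_le
      (fun i => Polynomial.C (l v i) + Polynomial.C (l e i) * Polynomial.X) (fun i => by
        rw [add_comm]
        exact Polynomial.natDegree_linear_le)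
    simpa using this
  let t : ι → ℂ := fun i => bracket v (w i) / bracket (w i) e
  have hinj : Set.InjOn t s := by
    intro i hi j hj hij
    by_contra hne
    have h1 := hwe i hi
    have h2 := hwe j hj
    simp only [t] at hij
    rw [div_eq_div_iff h1 h2] at hij
    have : bracket v e * bracket (w i) (w j) = 0 := by
      simp only [bracket] at hij ⊢
      linear_combination -hij
    exact (mul_ne_zero hve (hind i hi j hj hne)) this
  have hP0 : P = 0 := by
    refine Polynomial.eq_zero_of_natDegree_lt_card_of_eval_eq_zero' P (s.image t) ?_ ?_
    · intro x hx
      obtain ⟨i, hi, rfl⟩ := Finset.mem_image.mp hx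
      have h1 := hwe i hi
      have key : v + t i • e = (bracket v e / bracket (w i) e) • w i := by
        ext
        · simp only [t, Prod.fst_add, Prod.smul_fst, smul_eq_mul]
          field_simp
          simp only [bracket]
          ring
        · simp only [t, Prod.snd_add, Prod.smul_snd, smul_eq_mul]
          field_simp
          simp only [bracket]
          ring
      rw [hP, key, map_smul, IsHomogeneous_eval_smul hF, hzero i hi, mul_zero]
    · rw [Finset.card_image_of_injOn hinj]
      exact lt_of_le_of_lt hdeg hcard
  have := hP 0
  rw [hP0] at this
  simpa using this.symm

section Degree

variable {T : (Fin 3 → ℂ) ≃ₗ[ℂ] (Fin 3 → ℂ)}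

lemma le_degree_of_vanishing {r n : ℕ} {L : Fin r → Set P2} {a : Fin r → ℂ × ℂ}
    (hL : ∀ i, IsTangentAt T (L i) (a i)) (ha : ∀ i, a i ≠ 0)
    (hind : ∀ i j, i ≠ j → bracket (a i) (a j) ≠ 0) {F : MvPolynomial (Fin 3) ℂ}
    (hF : F.IsHomogeneous n) (hF0 : F ≠ 0) (hzero : ∀ p ∈ starConfig L, eval p.rep F = 0) :
    r ≤ n + 1 := by
  by_contra! hn
  let l : ℂ × ℂ → ℂ × ℂ →ₗ[ℂ] (Fin 3 → ℂ) := fun u => T.symm.toLinearMap ∘ₗ symProdLin u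
  have hl : ∀ u v, l u v = T.symm (symProd u v) := fun u v => rfl
  have hcomm : ∀ u v, l u v = l v u := fun u v => by rw [hl, hl, symProd_comm]
  have h1 : ∀ i j, i ≠ j → eval (l (a i) (a j)) F = 0 := by
    intro i j hij
    obtain ⟨p, k, hk, hp⟩ := exists_point_symProd T (ha i) (ha j)
    obtain ⟨hi, hj⟩ := point_mem_of_bracket_eq_zero (hL i) (hL j) hp
      (by rw [bracket_smul_left, bracket_self, mul_zero]) (bracket_self _)
    have := hzero p ⟨i, j, hij, hi, hj⟩
    rw [← T.symm_apply_apply p.rep, hp, symProd_smul_left, map_smul,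
      IsHomogeneous_eval_smul hF] at this
    exact (mul_eq_zero.mp this).resolve_left (pow_ne_zero _ hk)
  have h2 : ∀ i v, v ≠ 0 → eval (l (a i) v) F = 0 := by
    intro i v hv
    refine eval_eq_zero_of_card_lt hF (l (a i)) (Finset.univ.erase i) a (fun j _ => ha j)
      (fun j _ k _ => hind j k) (fun j hj => h1 i j (Finset.ne_of_mem_erase hj).symm) ?_ hv
    rw [Finset.card_erase_of_mem (Finset.mem_univ i), Finset.card_fin]
    omega
  have h3 : ∀ u v, u ≠ 0 → v ≠ 0 → eval (l u v) F = 0 := by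
    intro u v hu hv
    rw [hcomm]
    refine eval_eq_zero_of_card_lt hF (l v) Finset.univ a (fun j _ => ha j)
      (fun j _ k _ => hind j k) (fun j _ => by rw [hcomm]; exact h2 j v hv) ?_ hu
    rw [Finset.card_fin]
    omega
  have h4 : F * X 0 = 0 := by
    refine MvPolynomial.funext fun x => ?_
    rw [map_mul, map_zero, eval_X, mul_eq_zero]
    by_cases hx : x = 0
    · simp [hx]
    · left
      obtain ⟨u, v, h⟩ := exists_eq_symProd (T x)
      have h0 : symProd u v ≠ 0 := by
        rw [← h]
        simpa using hx
      have := h3 u v (left_ne_zero_of_symProd h0) (left_ne_zero_of_symProd (symProd_comm u v ▸ h0))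
      rwa [hl, ← h, T.symm_apply_apply] at this
  exact (mul_ne_zero hF0 (MvPolynomial.X_ne_zero 0)) h4

end Degree

lemma choose_two_succ_add_self (n : ℕ) : (n + 1).choose 2 + (n + 1).choose 2 = n * (n + 1) := by
  induction n with
  | zero => simp
  | succ k ih =>
    have h1 := Nat.choose_succ_succ' (k + 1) 1
    simp only [Nat.choose_one_right, Nat.reduceAdd] at h1
    nlinarith

lemma choose_two_succ_add_choose_two (n : ℕ) : (n + 1).choose 2 + n.choose 2 = n * n := by
  induction n with
  | zero => simp
  | succ k ih =>
    have h1 := Nat.choose_succ_succ' (k + 1) 1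
    have h2 := Nat.choose_succ_succ' k 1
    simp only [Nat.choose_one_right, Nat.reduceAdd] at h1 h2
    nlinarith

/-- The product of the brackets with the members of a family. -/
def bracketProd {ι : Type*} [Fintype ι] (a : ι → ℂ × ℂ) (u : ℂ × ℂ) : ℂ := ∏ i, bracket u (a i)

section BracketProd

variable {ι : Type*} [Fintype ι] {a : ι → ℂ × ℂ}

lemma bracketProd_eq_zero_iff {u : ℂ × ℂ} : bracketProd a u = 0 ↔ ∃ i, bracket u (a i) = 0 := by
  simp [bracketProd, Finset.prod_eq_zero_iff]

lemma continuous_bracket_left (w : ℂ × ℂ) : Continuous fun u => bracket u w := by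
  unfold bracket
  fun_prop

lemma continuous_bracketProd : Continuous (bracketProd a) :=
  continuous_finsetProd _ fun i _ => continuous_bracket_left (a i)

lemma bracketProd_cons {n : ℕ} (c : ℂ × ℂ) (b : Fin n → ℂ × ℂ) (u : ℂ × ℂ) :
    bracketProd (Fin.cons c b : Fin (n + 1) → ℂ × ℂ) u = bracket u c * bracketProd b u := by
  simp [bracketProd, Fin.prod_univ_succ]

/-- An identity divisible by `bracket u v` may be divided by it, also where it vanishes. -/
lemma eq_of_bracket_mul_eq {u v : ℂ × ℂ} (hu : u ≠ 0) {E K : ℂ × ℂ → ℂ} (hE : Continuous E)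
    (hK : Continuous K) (h : ∀ v, bracket u v * E v = bracket u v * K v) : E v = K v := by
  by_cases huv : bracket u v = 0
  · obtain ⟨e, he⟩ := exists_bracket_ne_zero hu
    have hline : Continuous fun t : ℂ => v + t • e := by fun_prop
    have hext : (fun t : ℂ => E (v + t • e)) = fun t => K (v + t • e) := by
      refine Continuous.ext_on (dense_compl_singleton (0 : ℂ)) (hE.comp hline) (hK.comp hline) ?_
      intro t ht
      refine mul_left_cancel₀ ?_ (h (v + t • e))
      have : bracket u (v + t • e) = t * bracket u e := by
        simp only [bracket, Prod.fst_add, Prod.snd_add, Prod.smul_fst, Prod.smul_snd,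
          smul_eq_mul] at huv ⊢
        linear_combination huv
      rw [this]
      exact mul_ne_zero ht he
    simpa using congrFun hext 0
  · exact mul_left_cancel₀ huv (h v)

lemma ne_zero_of_bracket_mul_eq_mul_bracketProd
    (hind : ∀ i j, i ≠ j → bracket (a i) (a j) ≠ 0) (ha : ∀ i, a i ≠ 0)
    {u v : ℂ × ℂ} (hu : u ≠ 0) (hv : v ≠ 0) (huv : bracket u v = 0) (hau : bracketProd a u = 0)
    {E M : ℂ × ℂ → ℂ} (hE : Continuous E) (hM : Continuous M)
    (h : ∀ v, bracket u v * E v = M v * bracketProd a v) (hMv : M v ≠ 0) : E v ≠ 0 := by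
  classical
  obtain ⟨i, hi⟩ := bracketProd_eq_zero_iff.mp hau
  obtain ⟨k, hk⟩ := exists_smul_of_bracket_eq_zero hu hi
  have hk0 : k ≠ 0 := by
    rintro rfl
    exact ha i (by rw [hk, zero_smul])
  have hswap : ∀ v, bracket v (a i) = -k * bracket u v := fun v => by
    rw [hk, bracket_swap, bracket_smul_left, neg_mul]
  have hsplit : ∀ v, bracketProd a v =
      bracket v (a i) * ∏ j ∈ Finset.univ.erase i, bracket v (a j) := fun v =>
    (Finset.mul_prod_erase _ _ (Finset.mem_univ i)).symm
  have hK : Continuous fun v => -k * M v * ∏ j ∈ Finset.univ.erase i, bracket v (a j) :=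
    (continuous_const.mul hM).mul
      (continuous_finsetProd _ fun j _ => continuous_bracket_left (a j))
  rw [eq_of_bracket_mul_eq (v := v) hu hE hK fun v => by rw [h, hsplit, hswap]; ring]
  refine mul_ne_zero (mul_ne_zero (neg_ne_zero.mpr hk0) hMv) (Finset.prod_ne_zero_iff.mpr ?_)
  intro j hj h0
  refine hind i j (Finset.ne_of_mem_erase hj).symm ?_
  refine bracket_eq_zero_trans hv ?_ (by rw [bracket_swap, h0, neg_zero])
  rw [hk, bracket_smul_left, huv, mul_zero]

variable {κ : Type*} [Fintype κ] {b : κ → ℂ × ℂ}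

lemma bracketProd_ne_zero_of_eq_zero (hab : ∀ i j, bracket (a i) (b j) ≠ 0) {u : ℂ × ℂ}
    (hu : u ≠ 0) (h : bracketProd a u = 0) : bracketProd b u ≠ 0 := by
  intro h'
  obtain ⟨i, hi⟩ := bracketProd_eq_zero_iff.mp h
  obtain ⟨j, hj⟩ := bracketProd_eq_zero_iff.mp h'
  exact hab i j (bracket_eq_zero_trans hu (by rw [bracket_swap, hi, neg_zero])
    (by rw [bracket_swap, hj, neg_zero]))

lemma bracketProd_eq_zero_or (hab : ∀ i j, bracket (a i) (b j) ≠ 0) {u v : ℂ × ℂ}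
    (hu : u ≠ 0) (hv : v ≠ 0) (h : bracketProd a u * bracketProd b v = 0)
    (h' : bracketProd a v * bracketProd b u = 0) :
    (bracketProd a u = 0 ∧ bracketProd a v = 0) ∨ (bracketProd b u = 0 ∧ bracketProd b v = 0) := by
  rcases mul_eq_zero.mp h with h | h
  · exact .inl ⟨h, (mul_eq_zero.mp h').resolve_right (bracketProd_ne_zero_of_eq_zero hab hu h)⟩
  · exact .inr ⟨(mul_eq_zero.mp h').resolve_left
      fun h0 => bracketProd_ne_zero_of_eq_zero hab hv h0 h, h⟩

lemma bracketProd_eq_zero_of_bracket_eq_zero {u v : ℂ × ℂ} (hv : v ≠ 0) (huv : bracket u v = 0)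
    (h : bracketProd a v = 0) : bracketProd a u = 0 := by
  obtain ⟨i, hi⟩ := bracketProd_eq_zero_iff.mp h
  exact bracketProd_eq_zero_iff.mpr
    ⟨i, bracket_eq_zero_trans hv huv (by rw [bracket_swap, hi, neg_zero])⟩

end BracketProd

section Bezoutian

variable (T : (Fin 3 → ℂ) ≃ₗ[ℂ] (Fin 3 → ℂ))

/-- The symmetrization of `bracketProd a u * bracketProd b v`, and its antisymmetrization divided
by `bracket u v`, are forms in the coefficients of the product of `u` and `v`. -/
lemma exists_bezoutian {n : ℕ} (a b : Fin (n + 1) → ℂ × ℂ) :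
    ∃ S B : MvPolynomial (Fin 3) ℂ, S.IsHomogeneous (n + 1) ∧ B.IsHomogeneous n ∧
      ∀ x u v, T x = symProd u v →
        eval x S = bracketProd a u * bracketProd b v + bracketProd a v * bracketProd b u ∧
        bracket u v * eval x B =
          bracketProd a u * bracketProd b v - bracketProd a v * bracketProd b u := by
  let y : Fin 3 → (Fin 3 → ℂ) →ₗ[ℂ] ℂ := fun i => LinearMap.proj i ∘ₗ T.toLinearMap
  have hy : ∀ i x, y i x = T x i := fun i x => rfl
  let q : ℂ × ℂ → ℂ × ℂ → MvPolynomial (Fin 3) ℂ := fun c d => linPoly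
    ((2 * c.2 * d.2) • y 0 - (c.2 * d.1 + c.1 * d.2) • y 1 + (2 * c.1 * d.1) • y 2)
  have hq : ∀ c d, (q c d).IsHomogeneous 1 := fun c d => isHomogeneous_linPoly _
  have hqe : ∀ c d x u v, T x = symProd u v →
      eval x (q c d) = bracket u c * bracket v d + bracket v c * bracket u d := by
    intro c d x u v h
    simp only [q, eval_linPoly, LinearMap.add_apply, LinearMap.sub_apply, LinearMap.smul_apply,
      hy, h, smul_eq_mul, symProd, bracket, Matrix.cons_val_zero, Matrix.cons_val_one,
      Matrix.cons_val]
    ring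
  have hbr : ∀ c d u v : ℂ × ℂ, bracket u c * bracket v d - bracket v c * bracket u d =
      bracket u v * bracket c d := by
    intro c d u v
    simp only [bracket]
    ring
  induction n with
  | zero =>
    refine ⟨q (a 0) (b 0), C (bracket (a 0) (b 0)), hq _ _, isHomogeneous_C _ _, ?_⟩
    intro x u v h
    simp only [bracketProd, Fin.prod_univ_succ, Finset.univ_eq_empty, Finset.prod_empty, mul_one,
      eval_C, hbr, and_true]
    exact hqe _ _ _ _ _ h
  | succ n ih =>
    obtain ⟨S, B, hS, hB, hSB⟩ := ih (fun i => a i.succ) (fun i => b i.succ)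
    let D : MvPolynomial (Fin 3) ℂ := linPoly (y 1) ^ 2 - C 4 * (linPoly (y 0) * linPoly (y 2))
    have hD : D.IsHomogeneous 2 := by
      refine IsHomogeneous.sub ?_ ?_
      · simpa using (isHomogeneous_linPoly (y 1)).pow 2
      · exact IsHomogeneous.C_mul
          ((isHomogeneous_linPoly (y 0)).mul (isHomogeneous_linPoly (y 2))) 4
    have hDe : ∀ x u v, T x = symProd u v → eval x D = bracket u v ^ 2 := by
      intro x u v h
      simp only [D, map_sub, map_pow, map_mul, eval_C, eval_linPoly, hy, h, symProd, bracket,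
        Matrix.cons_val_zero, Matrix.cons_val_one, Matrix.cons_val]
      ring
    refine ⟨C (1 / 2) * (S * q (a 0) (b 0) + C (bracket (a 0) (b 0)) * (D * B)),
      C (1 / 2) * (B * q (a 0) (b 0) + C (bracket (a 0) (b 0)) * S), ?_, ?_, ?_⟩
    · refine IsHomogeneous.C_mul (IsHomogeneous.add (hS.mul (hq _ _)) ?_) _
      have := IsHomogeneous.C_mul (hD.mul hB) (bracket (a 0) (b 0))
      rwa [show 2 + n = n + 1 + 1 by ring] at this
    · exact IsHomogeneous.C_mul
        (IsHomogeneous.add (hB.mul (hq _ _)) (IsHomogeneous.C_mul hS _)) _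
    · intro x u v h
      obtain ⟨h1, h2⟩ := hSB x u v h
      have h3 := hqe (a 0) (b 0) x u v h
      have h4 := hDe x u v h
      have h5 := hbr (a 0) (b 0) u v
      have hsplit : ∀ (f : Fin (n + 1 + 1) → ℂ × ℂ) w,
          bracketProd f w = bracket w (f 0) * bracketProd (fun i : Fin (n + 1) => f i.succ) w := by
        intro f w
        simp only [bracketProd, Fin.prod_univ_succ (n := n + 1)]
      simp only [hsplit a, hsplit b, map_mul, map_add, eval_C, h3, h4]
      generalize bracketProd (fun i : Fin (n + 1) => a i.succ) u = au at *
      generalize bracketProd (fun i : Fin (n + 1) => a i.succ) v = av at *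
      generalize bracketProd (fun i : Fin (n + 1) => b i.succ) u = bu at *
      generalize bracketProd (fun i : Fin (n + 1) => b i.succ) v = bv at *
      constructor
      · rw [h1]
        linear_combination (1 / 2) * bracket u v * bracket (a 0) (b 0) * h2 -
          (1 / 2) * (au * bv - av * bu) * h5
      · rw [h1]
        linear_combination (1 / 2) * (bracket u (a 0) * bracket v (b 0) +
          bracket v (a 0) * bracket u (b 0)) * h2 - (1 / 2) * (au * bv + av * bu) * h5

lemma continuous_eval_symProd (F : MvPolynomial (Fin 3) ℂ) (u : ℂ × ℂ) :
    Continuous fun v => eval (T.symm (symProd u v)) F :=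
  (MvPolynomial.continuous_eval F).comp
    (LinearMap.continuous_of_finiteDimensional (T.symm.toLinearMap ∘ₗ symProdLin u))

end Bezoutian

section CompleteIntersection

variable {T : (Fin 3 → ℂ) ≃ₗ[ℂ] (Fin 3 → ℂ)}

lemma exists_factors_of_mem_starConfig {r : ℕ} {L : Fin r → Set P2} {a : Fin r → ℂ × ℂ}
    (hL : ∀ i, IsTangentAt T (L i) (a i)) (hind : ∀ i j, i ≠ j → bracket (a i) (a j) ≠ 0)
    {p : P2} (hp : p ∈ starConfig L) :
    ∃ u v, T p.rep = symProd u v ∧ bracket u v ≠ 0 ∧ bracketProd a u = 0 ∧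
      bracketProd a v = 0 := by
  obtain ⟨i, j, hij, hi, hj⟩ := hp
  obtain ⟨k, hk, h⟩ := (hL i).eq_smul_symProd (hL j) (hind i j hij) hi hj
  refine ⟨_, _, h, ?_, bracketProd_eq_zero_iff.mpr ⟨i, ?_⟩,
    bracketProd_eq_zero_iff.mpr ⟨j, bracket_self _⟩⟩
  · rw [bracket_smul_left]
    exact mul_ne_zero hk (hind i j hij)
  · rw [bracket_smul_left, bracket_self, mul_zero]

lemma mem_starConfig_of_bracketProd_eq_zero {r : ℕ} {L : Fin r → Set P2} {a : Fin r → ℂ × ℂ}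
    (hL : ∀ i, IsTangentAt T (L i) (a i)) (ha : ∀ i, a i ≠ 0) {p : P2} {u v : ℂ × ℂ}
    (hp : T p.rep = symProd u v) (huv : bracket u v ≠ 0) (hu : bracketProd a u = 0)
    (hv : bracketProd a v = 0) : p ∈ starConfig L := by
  obtain ⟨i, hi⟩ := bracketProd_eq_zero_iff.mp hu
  obtain ⟨j, hj⟩ := bracketProd_eq_zero_iff.mp hv
  refine ⟨i, j, ?_, point_mem_of_bracket_eq_zero (hL i) (hL j) hp hi hj⟩
  rintro rfl
  exact huv (bracket_eq_zero_trans (ha i) hi hj)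

variable {r s : ℕ} {L : Fin r → Set P2} {M : Fin s → Set P2} {a : Fin r → ℂ × ℂ}
  {b : Fin s → ℂ × ℂ}

lemma mem_union_starConfig (hL : ∀ i, IsTangentAt T (L i) (a i))
    (hM : ∀ j, IsTangentAt T (M j) (b j)) (ha0 : ∀ i, a i ≠ 0) (hb0 : ∀ j, b j ≠ 0)
    (hab : ∀ i j, bracket (a i) (b j) ≠ 0) {p : P2} {u v : ℂ × ℂ} (hu : u ≠ 0) (hv : v ≠ 0)
    (hp : T p.rep = symProd u v) (huv : bracket u v ≠ 0)
    (h : bracketProd a u * bracketProd b v = 0) (h' : bracketProd a v * bracketProd b u = 0) :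
    p ∈ starConfig L ∪ starConfig M := by
  rcases bracketProd_eq_zero_or hab hu hv h h' with ⟨h1, h2⟩ | ⟨h1, h2⟩
  · exact .inl (mem_starConfig_of_bracketProd_eq_zero hL ha0 hp huv h1 h2)
  · exact .inr (mem_starConfig_of_bracketProd_eq_zero hM hb0 hp huv h1 h2)

lemma exists_factors_of_mem_union (hL : ∀ i, IsTangentAt T (L i) (a i))
    (hM : ∀ j, IsTangentAt T (M j) (b j))
    (ha : ∀ i j, i ≠ j → bracket (a i) (a j) ≠ 0) (hb : ∀ i j, i ≠ j → bracket (b i) (b j) ≠ 0)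
    {p : P2} (hp : p ∈ starConfig L ∪ starConfig M) :
    ∃ u v, T p.rep = symProd u v ∧ bracket u v ≠ 0 ∧ bracketProd a u * bracketProd b v = 0 ∧
      bracketProd a v * bracketProd b u = 0 := by
  rcases hp with hp | hp
  · obtain ⟨u, v, h, huv, h1, h2⟩ := exists_factors_of_mem_starConfig hL ha hp
    exact ⟨u, v, h, huv, by rw [h1, zero_mul], by rw [h2, zero_mul]⟩
  · obtain ⟨u, v, h, huv, h1, h2⟩ := exists_factors_of_mem_starConfig hM hb hp
    exact ⟨u, v, h, huv, by rw [h2, mul_zero], by rw [h1, mul_zero]⟩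

lemma isCI_union_of_eq {n : ℕ} {L M : Fin (n + 1) → Set P2} {a b : Fin (n + 1) → ℂ × ℂ}
    (hL : ∀ i, IsTangentAt T (L i) (a i)) (hM : ∀ j, IsTangentAt T (M j) (b j))
    (ha0 : ∀ i, a i ≠ 0) (hb0 : ∀ j, b j ≠ 0)
    (ha : ∀ i j, i ≠ j → bracket (a i) (a j) ≠ 0) (hb : ∀ i j, i ≠ j → bracket (b i) (b j) ≠ 0)
    (hab : ∀ i j, bracket (a i) (b j) ≠ 0) :
    IsCI (starConfig L ∪ starConfig M) n (n + 1) := by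
  obtain ⟨S, B, hS, hB, hSB⟩ := exists_bezoutian T a b
  have ha00 : bracketProd a (a 0) = 0 := bracketProd_eq_zero_iff.mpr ⟨0, bracket_self _⟩
  have hb00 : bracketProd b (b 0) = 0 := bracketProd_eq_zero_iff.mpr ⟨0, bracket_self _⟩
  have hba : ∀ i j, bracket (b i) (a j) ≠ 0 := fun i j => by
    rw [bracket_swap]
    exact neg_ne_zero.mpr (hab j i)
  have hab0 : bracketProd a (b 0) * bracketProd b (a 0) ≠ 0 :=
    mul_ne_zero (bracketProd_ne_zero_of_eq_zero hba (hb0 0) hb00)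
      (bracketProd_ne_zero_of_eq_zero hab (ha0 0) ha00)
  obtain ⟨h1, h2⟩ := hSB _ _ _ (T.apply_symm_apply (symProd (a 0) (b 0)))
  rw [ha00, zero_mul] at h1 h2
  refine ⟨B, S, ?_, ?_, hB, hS, ?_, ?_⟩
  · rintro rfl
    rw [map_zero, mul_zero, zero_sub] at h2
    exact neg_ne_zero.mpr hab0 h2.symm
  · rintro rfl
    rw [map_zero, zero_add] at h1
    exact hab0 h1.symm
  · refine Set.Subset.antisymm ?_ ?_
    · rintro p ⟨hpB, hpS⟩
      obtain ⟨u, v, hu, hv, hp⟩ := exists_point_factors T p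
      obtain ⟨h3, h4⟩ := hSB _ _ _ hp
      rw [show eval p.rep S = 0 from hpS] at h3
      rw [show eval p.rep B = 0 from hpB, mul_zero] at h4
      have h5 : bracketProd a u * bracketProd b v = 0 := by linear_combination (-h3 - h4) / 2
      have h6 : bracketProd a v * bracketProd b u = 0 := by linear_combination (h4 - h3) / 2
      by_cases huv : bracket u v = 0
      · exfalso
        have hE : eval (T.symm (symProd u v)) B = 0 := by
          rw [← hp, T.symm_apply_apply]
          exact hpB
        have hmul : ∀ w, bracket u w * eval (T.symm (symProd u w)) B =
            bracketProd a u * bracketProd b w - bracketProd a w * bracketProd b u :=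
          fun w => (hSB _ _ _ (T.apply_symm_apply _)).2
        rcases bracketProd_eq_zero_or hab hu hv h5 h6 with ⟨h7, -⟩ | ⟨h7, -⟩
        · refine ne_zero_of_bracket_mul_eq_mul_bracketProd ha ha0 hu hv huv h7
            (continuous_eval_symProd T B u) (continuous_const (y := -bracketProd b u))
            (fun w => ?_) (neg_ne_zero.mpr (bracketProd_ne_zero_of_eq_zero hab hu h7)) hE
          rw [hmul, h7]
          ring
        · refine ne_zero_of_bracket_mul_eq_mul_bracketProd hb hb0 hu hv huv h7
            (continuous_eval_symProd T B u) (continuous_const (y := bracketProd a u))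
            (fun w => ?_) (bracketProd_ne_zero_of_eq_zero hba hu h7) hE
          rw [hmul, h7]
          ring
      · exact mem_union_starConfig hL hM ha0 hb0 hab hu hv hp huv h5 h6
    · intro p hp
      obtain ⟨u, v, hp, huv, h5, h6⟩ := exists_factors_of_mem_union hL hM ha hb hp
      obtain ⟨h3, h4⟩ := hSB _ _ _ hp
      rw [h5, h6, sub_zero] at h4
      rw [h5, h6, add_zero] at h3
      exact ⟨(mul_eq_zero.mp h4).resolve_left huv, h3⟩
  · rw [ncard_starConfig_union hL hM ha0 hb0 ha hb hab, choose_two_succ_add_self]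

lemma exists_bracketProd_form (T : (Fin 3 → ℂ) ≃ₗ[ℂ] (Fin 3 → ℂ)) {n : ℕ}
    (a : Fin (n + 1) → ℂ × ℂ) (b : Fin n → ℂ × ℂ) (c : ℂ × ℂ) :
    ∃ B : MvPolynomial (Fin 3) ℂ, B.IsHomogeneous n ∧ ∀ x u v, T x = symProd u v →
      bracket u v * eval x B = bracketProd a u * bracketProd b v * bracket v c -
        bracketProd a v * bracketProd b u * bracket u c := by
  obtain ⟨_, B, -, hB, hSB⟩ := exists_bezoutian T a (Fin.cons c b)
  refine ⟨B, hB, fun x u v h => ?_⟩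
  rw [(hSB x u v h).2, bracketProd_cons, bracketProd_cons]
  ring

lemma bracket_ne_zero_or {c d : ℂ × ℂ} (hcd : bracket c d ≠ 0) {u : ℂ × ℂ} (hu : u ≠ 0) :
    bracket u c ≠ 0 ∨ bracket u d ≠ 0 := by
  by_contra! h
  exact hcd (bracket_eq_zero_trans hu (by rw [bracket_swap, h.1, neg_zero])
    (by rw [bracket_swap, h.2, neg_zero]))

lemma isCI_union_of_succ {n : ℕ} (hn : 0 < n) {L : Fin (n + 1) → Set P2} {M : Fin n → Set P2}
    {a : Fin (n + 1) → ℂ × ℂ} {b : Fin n → ℂ × ℂ}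
    (hL : ∀ i, IsTangentAt T (L i) (a i)) (hM : ∀ j, IsTangentAt T (M j) (b j))
    (ha0 : ∀ i, a i ≠ 0) (hb0 : ∀ j, b j ≠ 0)
    (ha : ∀ i j, i ≠ j → bracket (a i) (a j) ≠ 0) (hb : ∀ i j, i ≠ j → bracket (b i) (b j) ≠ 0)
    (hab : ∀ i j, bracket (a i) (b j) ≠ 0) :
    IsCI (starConfig L ∪ starConfig M) n n := by
  let k : Fin n := ⟨0, hn⟩
  let c := a k.succ
  let d := b k
  have hcd : bracket c d ≠ 0 := hab _ _
  have hba : ∀ i j, bracket (b i) (a j) ≠ 0 := fun i j => by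
    rw [bracket_swap]
    exact neg_ne_zero.mpr (hab j i)
  have ha00 : bracketProd a (a 0) = 0 := bracketProd_eq_zero_iff.mpr ⟨0, bracket_self _⟩
  have hbk : bracketProd b (b k) = 0 := bracketProd_eq_zero_iff.mpr ⟨k, bracket_self _⟩
  have hab0 : bracketProd a (b k) * bracketProd b (a 0) ≠ 0 :=
    mul_ne_zero (bracketProd_ne_zero_of_eq_zero hba (hb0 k) hbk)
      (bracketProd_ne_zero_of_eq_zero hab (ha0 0) ha00)
  choose B hB hBe using exists_bracketProd_form T a b
  have hBne : ∀ e, bracket (a 0) e ≠ 0 → B e ≠ 0 := by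
    intro e he h0
    have := hBe e _ _ _ (T.apply_symm_apply (symProd (a 0) (b k)))
    rw [h0, map_zero, mul_zero, ha00, zero_mul, zero_mul, zero_sub] at this
    exact neg_ne_zero.mpr (mul_ne_zero hab0 he) this.symm
  refine ⟨B c, B d, hBne c (ha _ _ (Fin.succ_ne_zero k).symm), hBne d (hab _ _), hB c, hB d,
    ?_, ?_⟩
  · refine Set.Subset.antisymm ?_ ?_
    · rintro p ⟨hpc, hpd⟩
      obtain ⟨u, v, hu, hv, hp⟩ := exists_point_factors T p
      by_cases huv : bracket u v = 0
      · exfalso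
        have hE : ∀ e, eval p.rep (B e) = 0 → eval (T.symm (symProd u v)) (B e) = 0 := by
          intro e he
          rwa [← hp, T.symm_apply_apply]
        have hEc := hE c hpc
        have hEd := hE d hpd
        have hmul : ∀ e w, bracket u w * eval (T.symm (symProd u w)) (B e) =
            bracketProd a u * bracketProd b w * bracket w e -
              bracketProd a w * bracketProd b u * bracket u e :=
          fun e w => hBe e _ _ _ (T.apply_symm_apply _)
        have hdiag : bracket u d * eval (T.symm (symProd u v)) (B c) -
            bracket u c * eval (T.symm (symProd u v)) (B d) =
              -(bracketProd a u * bracketProd b v * bracket c d) := by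
          refine eq_of_bracket_mul_eq (v := v) hu (E := fun v =>
              bracket u d * eval (T.symm (symProd u v)) (B c) -
                bracket u c * eval (T.symm (symProd u v)) (B d))
            (K := fun v => -(bracketProd a u * bracketProd b v * bracket c d))
            ((continuous_const.mul (continuous_eval_symProd T _ u)).sub
              (continuous_const.mul (continuous_eval_symProd T _ u)))
            ((continuous_const.mul continuous_bracketProd).mul continuous_const).neg fun w => ?_
          have h1 := hmul c w
          have h2 := hmul d w
          have h3 : bracket u d * bracket w c - bracket u c * bracket w d =
              -(bracket u w * bracket c d) := by
            simp only [bracket]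
            ring
          linear_combination bracket u d * h1 - bracket u c * h2 +
            bracketProd a u * bracketProd b w * h3
        rw [hEc, hEd, mul_zero, mul_zero, sub_zero, zero_eq_neg] at hdiag
        rcases mul_eq_zero.mp ((mul_eq_zero.mp hdiag).resolve_right hcd) with h7 | h7
        · have aux : ∀ e, bracket u e ≠ 0 → eval (T.symm (symProd u v)) (B e) ≠ 0 := by
            intro e he
            refine ne_zero_of_bracket_mul_eq_mul_bracketProd ha ha0 hu hv huv h7
              (continuous_eval_symProd T (B e) u)
              (continuous_const (y := -(bracketProd b u * bracket u e))) (fun w => ?_)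
              (neg_ne_zero.mpr (mul_ne_zero (bracketProd_ne_zero_of_eq_zero hab hu h7) he))
            rw [hmul, h7]
            ring
          rcases bracket_ne_zero_or hcd hu with he | he
          · exact aux c he hEc
          · exact aux d he hEd
        · have h8 := bracketProd_eq_zero_of_bracket_eq_zero hv huv h7
          have aux : ∀ e, bracket v e ≠ 0 → eval (T.symm (symProd u v)) (B e) ≠ 0 := by
            intro e he
            refine ne_zero_of_bracket_mul_eq_mul_bracketProd hb hb0 hu hv huv h8
              (continuous_eval_symProd T (B e) u)
              (M := fun w => bracketProd a u * bracket w e)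
              (continuous_const.mul (continuous_bracket_left e)) (fun w => ?_)
              (mul_ne_zero (bracketProd_ne_zero_of_eq_zero hba hu h8) he)
            rw [hmul, h8]
            ring
          rcases bracket_ne_zero_or hcd hv with he | he
          · exact aux c he hEc
          · exact aux d he hEd
      · have h1 := hBe c _ _ _ hp
        have h2 := hBe d _ _ _ hp
        rw [hpc, mul_zero] at h1
        rw [hpd, mul_zero] at h2
        have h3 : bracket u d * bracket v c - bracket u c * bracket v d =
            -(bracket u v * bracket c d) := by
          simp only [bracket]
          ring
        have h4 : bracket u v * bracket c d ≠ 0 := mul_ne_zero huv hcd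
        refine mem_union_starConfig hL hM ha0 hb0 hab hu hv hp huv
          ((mul_eq_zero.mp ?_).resolve_right h4) ((mul_eq_zero.mp ?_).resolve_right h4)
        · linear_combination bracket u d * h1 - bracket u c * h2 +
            bracketProd a u * bracketProd b v * h3
        · linear_combination bracket v d * h1 - bracket v c * h2 +
            bracketProd a v * bracketProd b u * h3
    · intro p hp
      obtain ⟨u, v, hp, huv, h5, h6⟩ := exists_factors_of_mem_union hL hM ha hb hp
      have aux : ∀ e, eval p.rep (B e) = 0 := by
        intro e
        have := hBe e _ _ _ hp
        rw [h5, h6, zero_mul, zero_mul, sub_zero] at this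
        exact (mul_eq_zero.mp this).resolve_left huv
      exact ⟨aux c, aux d⟩
  · rw [ncard_starConfig_union hL hM ha0 hb0 ha hb hab, choose_two_succ_add_choose_two]

end CompleteIntersection

/-- **The union of two contact star configurations is a complete intersection iff
`s = r` or `s = r−1`.**
Let `γ` be an irreducible conic and `ℓ₁,…,ℓ_r, m₁,…,m_s` pairwise distinct lines tangent
to `γ`, `r ≥ s ≥ 2`, with contact star configurations `X` and `Y`.  Then `X ∪ Y` is a
complete intersection of some type `(a,b)` if and only if `s = r` or `s = r−1`. -/
theorem two_contact_stars_ci_iff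
    (γ : Set P2) (hγ : IsIrredConic γ) (r s : ℕ) (hs : 2 ≤ s) (hsr : s ≤ r)
    (ℓ : Fin r → Set P2) (m : Fin s → Set P2)
    (hℓline : ∀ i, IsLine (ℓ i)) (hmline : ∀ j, IsLine (m j))
    (hℓtan : ∀ i, IsTangent (ℓ i) γ) (hmtan : ∀ j, IsTangent (m j) γ)
    (hℓinj : Function.Injective ℓ) (hminj : Function.Injective m)
    (hcross : ∀ i j, ℓ i ≠ m j) :
    (∃ a b : ℕ, IsCI (starConfig ℓ ∪ starConfig m) a b) ↔ (s = r ∨ s = r - 1) := by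
  obtain ⟨T, hT⟩ := exists_discriminant_coordinates hγ
  choose a ha0 hL using fun i => exists_isTangentAt hT (hℓline i) (hℓtan i)
  choose b hb0 hM using fun j => exists_isTangentAt hT (hmline j) (hmtan j)
  have ha : ∀ i j, i ≠ j → bracket (a i) (a j) ≠ 0 := fun i j hij =>
    IsTangentAt.bracket_ne_zero (ha0 i) (ha0 j) (hL i) (hL j) (hℓinj.ne hij)
  have hb : ∀ i j, i ≠ j → bracket (b i) (b j) ≠ 0 := fun i j hij =>
    IsTangentAt.bracket_ne_zero (hb0 i) (hb0 j) (hM i) (hM j) (hminj.ne hij)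
  have hab : ∀ i j, bracket (a i) (b j) ≠ 0 := fun i j =>
    IsTangentAt.bracket_ne_zero (ha0 i) (hb0 j) (hL i) (hM j) (hcross i j)
  constructor
  · rintro ⟨d, e, F, G, hF0, hG0, hF, hG, hzero, hcard⟩
    have hd : r ≤ d + 1 := le_degree_of_vanishing hL ha0 ha hF hF0 fun p hp =>
      (hzero.symm ▸ Set.mem_union_left _ hp :
        p ∈ {p : P2 | eval p.rep F = 0 ∧ eval p.rep G = 0}).1
    have he : r ≤ e + 1 := le_degree_of_vanishing hL ha0 ha hG hG0 fun p hp =>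
      (hzero.symm ▸ Set.mem_union_left _ hp :
        p ∈ {p : P2 | eval p.rep F = 0 ∧ eval p.rep G = 0}).2
    rw [ncard_starConfig_union hL hM ha0 hb0 ha hb hab] at hcard
    by_contra! hne
    obtain ⟨n, rfl⟩ : ∃ n, r = n + 2 := ⟨r - 2, by omega⟩
    have h1 : s.choose 2 ≤ n.choose 2 := Nat.choose_le_choose 2 (by omega)
    have h2 := choose_two_succ_add_choose_two n
    have h3 : (n + 2).choose 2 = (n + 1) + (n + 1).choose 2 := by
      rw [Nat.choose_succ_succ', Nat.choose_one_right]
    have h4 : (n + 1) * (n + 1) ≤ d * e := Nat.mul_le_mul (by omega) (by omega)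
    have h5 : 2 ≤ n := by omega
    nlinarith
  · rintro (rfl | h)
    · obtain ⟨n, rfl⟩ : ∃ n, s = n + 1 := ⟨s - 1, by omega⟩
      exact ⟨n, n + 1, isCI_union_of_eq hL hM ha0 hb0 ha hb hab⟩
    · obtain rfl : r = s + 1 := by omega
      exact ⟨s, s, isCI_union_of_succ (by omega) hL hM ha0 hb0 ha hb hab⟩
end
end

section
/- Let s ≥ 2 and t ≥ 1, and let m₁,…,m_{s+t} be distinct lines in ℙ² meeting properly. Let X = 𝕊(m₁,…,m_{s+t}) and Y = 𝕊(m₁,…,m_s) ⊆ X. Then the h-vector of X ∖ Y is given by: h_{X∖Y}(d) = d+1 for 0 ≤ d ≤ t−2, h_{X∖Y}(d) = t for t−1 ≤ d ≤ t+s−2, and h_{X∖Y}(d) = 0 for d ≥ t+s−1. -/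
open MvPolynomial

noncomputable section

/-- The linear form with coefficient vector `a`. -/
def linForm (a : Fin 3 → ℂ) : MvPolynomial (Fin 3) ℂ := ∑ i, C (a i) * X i

lemma eval_linForm (a x : Fin 3 → ℂ) : eval x (linForm a) = a ⬝ᵥ x := by
  simp [linForm, dotProduct]

lemma isHomogeneous_linForm (a : Fin 3 → ℂ) : (linForm a).IsHomogeneous 1 :=
  IsHomogeneous.sum _ _ _ fun i _ => isHomogeneous_C_mul_X (a i) i

lemma coeff_linForm (a : Fin 3 → ℂ) (i : Fin 3) :
    (linForm a).coeff (Finsupp.single i 1) = a i := by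
  rw [linForm, coeff_sum, Finset.sum_eq_single i]
  · simp
  · intro j _ hj
    rw [coeff_C_mul, coeff_X, if_neg]
    · simp
    · rwa [Finsupp.single_left_inj one_ne_zero]
  · simp

lemma linForm_ne_zero {a : Fin 3 → ℂ} (ha : a ≠ 0) : linForm a ≠ 0 := by
  obtain ⟨i, hi⟩ := Function.ne_iff.mp ha
  intro h
  apply hi
  rw [← coeff_linForm a i, h]
  simp

lemma prime_linForm {a : Fin 3 → ℂ} (ha : a ≠ 0) : Prime (linForm a) := by
  refine (irreducible_of_totalDegree_eq_one
    ((isHomogeneous_linForm a).totalDegree (linForm_ne_zero ha)) fun x hx => ?_).prime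
  obtain ⟨i, hi⟩ := Function.ne_iff.mp ha
  have h := hx (Finsupp.single i 1)
  rw [coeff_linForm] at h
  exact isUnit_of_dvd_unit h (isUnit_iff_ne_zero.mpr hi)

lemma linForm_add (a b : Fin 3 → ℂ) : linForm (a + b) = linForm a + linForm b := by
  simp [linForm, add_mul, Finset.sum_add_distrib]

lemma linForm_smul (c : ℂ) (a : Fin 3 → ℂ) : linForm (c • a) = C c * linForm a := by
  simp [linForm, Finset.mul_sum, mul_assoc]

/-- A linear form vanishing at `q` lies in the span of any two independent ones. -/
lemma mem_span_pair_of_dotProduct_eq_zero {u v w q : Fin 3 → ℂ}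
    (huv : LinearIndependent ℂ ![u, v]) (hq : q ≠ 0)
    (hu : u ⬝ᵥ q = 0) (hv : v ⬝ᵥ q = 0) (hw : w ⬝ᵥ q = 0) :
    w ∈ Submodule.span ℂ {u, v} := by
  by_contra h
  have hli : LinearIndependent ℂ ![w, u, v] :=
    linearIndependent_finCons.mpr ⟨huv, by simpa [Set.pair_comm] using h⟩
  have hdet : (Matrix.of ![w, u, v]).det ≠ 0 := by
    have := (Matrix.linearIndependent_rows_iff_isUnit (A := Matrix.of ![w, u, v])).mp hli
    exact ((Matrix.isUnit_iff_isUnit_det _).mp this).ne_zero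
  apply hdet
  rw [← Matrix.exists_mulVec_eq_zero_iff]
  refine ⟨q, hq, ?_⟩
  ext i
  fin_cases i <;> simp [Matrix.mulVec, hu, hv, hw]

lemma linForm_mem_of_mem_span {I : Ideal (MvPolynomial (Fin 3) ℂ)} {u v w : Fin 3 → ℂ}
    (hu : linForm u ∈ I) (hv : linForm v ∈ I) (hw : w ∈ Submodule.span ℂ {u, v}) :
    linForm w ∈ I := by
  obtain ⟨a, b, rfl⟩ := Submodule.mem_span_pair.mp hw
  rw [linForm_add, linForm_smul, linForm_smul]
  exact add_mem (I.mul_mem_left _ hu) (I.mul_mem_left _ hv)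

lemma aeval_mul_C_of_isHomogeneous {σ R : Type*} [CommSemiring R] {F : MvPolynomial σ R} {d : ℕ}
    (hF : F.IsHomogeneous d) (q : σ → R) (T : MvPolynomial σ R) :
    aeval (fun i => C (q i) * T) F = C (eval q F) * T ^ d := by
  rw [aeval_def, eval₂_eq, eval_eq, map_sum, Finset.sum_mul]
  refine Finset.sum_congr rfl fun α hα => ?_
  rw [hF.degree_eq_sum_deg_support hα, ← Finset.prod_pow_eq_pow_sum]
  simp [mul_pow, Finset.prod_mul_distrib, mul_assoc]

/-- A form vanishing at a point lies in the ideal of two independent linear forms through it. -/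
lemma mem_span_linForm_pair {u v q : Fin 3 → ℂ}
    (huv : LinearIndependent ℂ ![u, v]) (hq : q ≠ 0) (hu : u ⬝ᵥ q = 0) (hv : v ⬝ᵥ q = 0)
    {F : MvPolynomial (Fin 3) ℂ} {d : ℕ} (hF : F.IsHomogeneous d) (h0 : eval q F = 0) :
    F ∈ Ideal.span {linForm u, linForm v} := by
  set I : Ideal (MvPolynomial (Fin 3) ℂ) := Ideal.span {linForm u, linForm v} with hI
  have huI : linForm u ∈ I := Ideal.subset_span (by simp)
  have hvI : linForm v ∈ I := Ideal.subset_span (by simp)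
  obtain ⟨k, hk⟩ := Function.ne_iff.mp hq
  have hk : q k ≠ 0 := hk
  have key : (Ideal.Quotient.mkₐ ℂ I).comp (aeval fun i => C (q i) * (C (q k)⁻¹ * X k)) =
      Ideal.Quotient.mkₐ ℂ I := by
    ext i
    simp only [AlgHom.comp_apply, aeval_X, Ideal.Quotient.mkₐ_eq_mk]
    rw [Ideal.Quotient.eq]
    have hmem : linForm ((q i * (q k)⁻¹) • Pi.single k 1 - Pi.single i 1) ∈ I := by
      refine linForm_mem_of_mem_span huI hvI
        (mem_span_pair_of_dotProduct_eq_zero huv hq hu hv ?_)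
      simp [sub_dotProduct, smul_dotProduct, hk]
    have hX : ∀ j, linForm (Pi.single j 1) = X j := by
      intro j
      rw [linForm, Finset.sum_eq_single j] <;> simp +contextual
    rw [sub_eq_add_neg, ← neg_one_smul ℂ, linForm_add, linForm_smul, linForm_smul, hX, hX] at hmem
    simpa [mul_assoc, sub_eq_add_neg] using hmem
  have h := DFunLike.congr_fun key F
  rw [AlgHom.comp_apply, aeval_mul_C_of_isHomogeneous hF, h0] at h
  simp only [map_zero, zero_mul, Ideal.Quotient.mkₐ_eq_mk] at h
  exact Ideal.Quotient.eq_zero_iff_mem.mp h.symm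

/-- The forms of degree `d - n`, zero if `d < n`. -/
def shiftForms (d n : ℕ) : Submodule ℂ (MvPolynomial (Fin 3) ℂ) :=
  if n ≤ d then homogeneousSubmodule (Fin 3) ℂ (d - n) else ⊥

lemma shiftForms_of_le {d n : ℕ} (h : n ≤ d) :
    shiftForms d n = homogeneousSubmodule (Fin 3) ℂ (d - n) := if_pos h

lemma shiftForms_of_not_le {d n : ℕ} (h : ¬n ≤ d) : shiftForms d n = ⊥ := if_neg h

lemma shiftForms_add_one (d n : ℕ) : shiftForms (d + 1) (n + 1) = shiftForms d n := by
  simp [shiftForms]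

lemma isHomogeneous_mul_of_mem_shiftForms {d n : ℕ} {G B : MvPolynomial (Fin 3) ℂ} (hG : G.IsHomogeneous n)
    (hB : B ∈ shiftForms d n) : (G * B).IsHomogeneous d := by
  unfold shiftForms at hB
  split_ifs at hB with h
  · simpa [Nat.add_sub_cancel' h] using hG.mul hB
  · rw [(Submodule.mem_bot ℂ).mp hB, mul_zero]
    exact isHomogeneous_zero _ _ _

lemma mul_mem_shiftForms {d n : ℕ} {H C : MvPolynomial (Fin 3) ℂ} (hH : H.IsHomogeneous 1)
    (hC : C ∈ shiftForms (d + 1) (n + 1)) : H * C ∈ shiftForms (d + 1) n := by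
  rw [shiftForms_add_one] at hC
  by_cases h : n ≤ d
  · rw [shiftForms_of_le h] at hC
    rw [shiftForms_of_le (by omega), show d + 1 - n = 1 + (d - n) by omega]
    exact hH.mul hC
  · rw [shiftForms_of_not_le h, Submodule.mem_bot] at hC
    simp [hC]

lemma exists_isHomogeneous_of_mem_shiftForms {d n : ℕ} {B : MvPolynomial (Fin 3) ℂ}
    (hB : B ∈ shiftForms d n) : ∃ e, B.IsHomogeneous e := by
  unfold shiftForms at hB
  split_ifs at hB with h
  · exact ⟨_, hB⟩
  · rw [(Submodule.mem_bot ℂ).mp hB]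
    exact ⟨0, isHomogeneous_zero _ _ _⟩

lemma exists_homogeneousComponent_mul {G : MvPolynomial (Fin 3) ℂ} {n : ℕ}
    (hG : G.IsHomogeneous n) (B : MvPolynomial (Fin 3) ℂ) (d : ℕ) :
    ∃ B' ∈ shiftForms d n, homogeneousComponent d (G * B) = G * B' := by
  let _ : GradedAlgebra (homogeneousSubmodule (Fin 3) ℂ) := MvPolynomial.gradedAlgebra
  have key : ∀ (p : MvPolynomial (Fin 3) ℂ) i, (DirectSum.decompose
      (homogeneousSubmodule (Fin 3) ℂ) p i : MvPolynomial (Fin 3) ℂ) = homogeneousComponent i p :=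
    decomposition.decompose'_apply
  by_cases h : n ≤ d
  · refine ⟨homogeneousComponent (d - n) B, ?_, ?_⟩
    · simpa [shiftForms, h] using homogeneousComponent_isHomogeneous (d - n) B
    · rw [← key, ← key, DirectSum.coe_decompose_mul_of_left_mem_of_le _ hG h]
  · refine ⟨0, zero_mem _, ?_⟩
    rw [← key, DirectSum.coe_decompose_mul_of_left_mem_of_not_le _ hG h, mul_zero]

lemma exists_mem_shiftForms_of_mem_span_pair {F G H : MvPolynomial (Fin 3) ℂ} {d k n : ℕ}
    (hF : F.IsHomogeneous d) (hH : H.IsHomogeneous k) (hG : G.IsHomogeneous n)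
    (h : F ∈ Ideal.span {H, G}) :
    ∃ A ∈ shiftForms d k, ∃ B ∈ shiftForms d n, F = H * A + G * B := by
  obtain ⟨a, b, hab⟩ := Ideal.mem_span_pair.mp h
  obtain ⟨A, hA, hA'⟩ := exists_homogeneousComponent_mul hH a d
  obtain ⟨B, hB, hB'⟩ := exists_homogeneousComponent_mul hG b d
  refine ⟨A, hA, B, hB, ?_⟩
  rw [← hA', ← hB', ← map_add, mul_comm H, mul_comm G, hab, homogeneousComponent_eq_self hF]

lemma isHomogeneous_prod_linForm {ι : Type*} (T : Finset ι) (v : ι → Fin 3 → ℂ) :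
    (∏ i ∈ T, linForm (v i)).IsHomogeneous T.card := by
  simpa using IsHomogeneous.prod T (fun i => linForm (v i)) (fun _ => 1)
    fun i _ => isHomogeneous_linForm (v i)

/-- A form vanishing at the points `q i` of the line `u = 0` lies in the ideal generated by `u`
and the product of linear forms `v i` such that each `v i` vanishes, among these points, at `q i`
only. -/
lemma mem_span_linForm_prod {ι : Type*} [DecidableEq ι] {u : Fin 3 → ℂ} {v q : ι → Fin 3 → ℂ}
    {F : MvPolynomial (Fin 3) ℂ} {d : ℕ} (hF : F.IsHomogeneous d) (T : Finset ι)
    (hli : ∀ i ∈ T, LinearIndependent ℂ ![u, v i]) (hq : ∀ i ∈ T, q i ≠ 0)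
    (hu : ∀ i ∈ T, u ⬝ᵥ q i = 0) (hv : ∀ i ∈ T, v i ⬝ᵥ q i = 0)
    (hne : ∀ i ∈ T, ∀ j ∈ T, i ≠ j → v i ⬝ᵥ q j ≠ 0)
    (h0 : ∀ i ∈ T, eval (q i) F = 0) :
    F ∈ Ideal.span {linForm u, ∏ i ∈ T, linForm (v i)} := by
  induction T using Finset.induction_on with
  | empty =>
    have : Ideal.span {linForm u, 1} = ⊤ :=
      (Ideal.eq_top_iff_one _).mpr (Ideal.subset_span (by simp))
    simp [this]
  | insert j T hj ih =>
    simp only [Finset.forall_mem_insert] at hli hq hu hv hne h0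
    obtain ⟨A, -, B, hB, hAB⟩ := exists_mem_shiftForms_of_mem_span_pair hF
      (isHomogeneous_linForm u) (isHomogeneous_prod_linForm T v)
      (ih hli.2 hq.2 hu.2 hv.2 (fun i hi => (hne.2 i hi).2) h0.2)
    obtain ⟨e, he⟩ := exists_isHomogeneous_of_mem_shiftForms hB
    have hBj : eval (q j) B = 0 := by
      have h := h0.1
      rw [hAB, map_add, map_mul, map_mul, eval_linForm, hu.1, zero_mul, zero_add, map_prod] at h
      refine (mul_eq_zero.mp h).resolve_left (Finset.prod_ne_zero_iff.mpr fun i hi => ?_)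
      rw [eval_linForm]
      exact (hne.2 i hi).1 (ne_of_mem_of_not_mem hi hj)
    obtain ⟨a, b, rfl⟩ := Ideal.mem_span_pair.mp
      (mem_span_linForm_pair hli.1 hq.1 hu.1 hv.1 he hBj)
    rw [Finset.prod_insert hj, Ideal.mem_span_pair]
    refine ⟨A + (∏ i ∈ T, linForm (v i)) * a, b, ?_⟩
    rw [hAB]
    ring

lemma finrank_homogeneousSubmodule_fin_three (d : ℕ) :
    Module.finrank ℂ (homogeneousSubmodule (Fin 3) ℂ d) = (d + 2).choose 2 := by
  rw [homogeneousSubmodule_eq_finsupp_supported]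
  have h1 := Module.finrank_eq_nat_card_basis
    (basisRestrictSupport ℂ {α : Fin 3 →₀ ℕ | α.degree = d})
  have h2 : {α : Fin 3 →₀ ℕ | α.degree = d} =
      ((Finset.univ : Finset (Fin 3)).finsuppAntidiag d : Set (Fin 3 →₀ ℕ)) := by
    ext α
    simp [Finset.mem_finsuppAntidiag, Finsupp.degree_eq_sum]
  refine h1.trans ?_
  rw [h2, Nat.card_coe_set_eq, Set.ncard_coe_finset, Finset.card_finsuppAntidiag_nat_eq_choose]
  simp only [Finset.card_univ, Fintype.card_fin]
  rw [show 3 + d - 1 = d + 2 by omega, ← Nat.choose_symm_of_eq_add (by omega : d + 2 = 2 + d)]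

instance finiteDimensional_homogeneousSubmodule (d : ℕ) :
    FiniteDimensional ℂ (homogeneousSubmodule (Fin 3) ℂ d) :=
  Module.Finite.iff_fg.mpr (homogeneousSubmodule_fg (Fin 3) ℂ d)

instance finiteDimensional_shiftForms (d n : ℕ) : FiniteDimensional ℂ (shiftForms d n) := by
  by_cases h : n ≤ d
  · rw [shiftForms_of_le h]
    infer_instance
  · rw [shiftForms_of_not_le h]
    infer_instance

instance finiteDimensional_idealComp (W : Set P2) (d : ℕ) : FiniteDimensional ℂ (idealComp W d) :=
  Submodule.finiteDimensional_of_le inf_le_left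

lemma finrank_shiftForms (d n : ℕ) :
    Module.finrank ℂ (shiftForms d n) = (d + 2 - n).choose 2 := by
  by_cases h : n ≤ d
  · rw [shiftForms_of_le h, finrank_homogeneousSubmodule_fin_three]
    congr 1
    omega
  · rw [shiftForms_of_not_le h, finrank_bot, Nat.choose_eq_zero_of_lt]
    omega

lemma finrank_map_mulLeft {G : MvPolynomial (Fin 3) ℂ} (hG : G ≠ 0)
    (V : Submodule ℂ (MvPolynomial (Fin 3) ℂ)) :
    Module.finrank ℂ (V.map (LinearMap.mulLeft ℂ G)) = Module.finrank ℂ V :=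
  (LinearEquiv.finrank_eq
    (Submodule.equivMapOfInjective _ (mul_right_injective₀ hG) V)).symm

/-- Adding to `W'` the points `q i`, `i ∈ T`, on the line `u = 0`: the degree `d + 1` component of
the ideal of the new set `W`, when the product of the linear forms `v i` vanishes on `W`. -/
lemma idealComp_eq_sup {ι : Type*} [DecidableEq ι] {W W' : Set P2} {u : Fin 3 → ℂ}
    {v : ι → Fin 3 → ℂ} {q : ι → P2} {T : Finset ι}
    (hsub : W' ⊆ W) (hW' : ∀ p ∈ W', u ⬝ᵥ p.rep ≠ 0)
    (hW : ∀ p ∈ W, p ∈ W' ∨ u ⬝ᵥ p.rep = 0) (hT : ∀ p ∈ W, ∃ i ∈ T, v i ⬝ᵥ p.rep = 0)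
    (hli : ∀ i ∈ T, LinearIndependent ℂ ![u, v i]) (hq : ∀ i ∈ T, q i ∈ W)
    (hu : ∀ i ∈ T, u ⬝ᵥ (q i).rep = 0) (hv : ∀ i ∈ T, v i ⬝ᵥ (q i).rep = 0)
    (hne : ∀ i ∈ T, ∀ j ∈ T, i ≠ j → v i ⬝ᵥ (q j).rep ≠ 0) (d : ℕ) :
    idealComp W (d + 1) =
      (idealComp W' d).map (LinearMap.mulLeft ℂ (linForm u)) ⊔
      (shiftForms (d + 1) T.card).map (LinearMap.mulLeft ℂ (∏ i ∈ T, linForm (v i))) := by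
  have hG : ∀ p ∈ W, eval p.rep (∏ i ∈ T, linForm (v i)) = 0 := by
    intro p hp
    obtain ⟨i, hi, h⟩ := hT p hp
    rw [map_prod]
    exact Finset.prod_eq_zero hi (by rw [eval_linForm, h])
  apply le_antisymm
  · rintro F ⟨hF, hF0⟩
    obtain ⟨A, hA, B, hB, rfl⟩ := exists_mem_shiftForms_of_mem_span_pair hF
      (isHomogeneous_linForm u) (isHomogeneous_prod_linForm T v)
      (mem_span_linForm_prod hF T hli (fun i _ => (q i).rep_nonzero) hu hv hne
        fun i hi => hF0 _ (hq i hi))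
    refine Submodule.add_mem_sup ⟨A, ⟨?_, fun p hp => ?_⟩, rfl⟩ ⟨B, hB, rfl⟩
    · rwa [shiftForms_of_le (by omega)] at hA
    · have h := hF0 p (hsub hp)
      rw [map_add, map_mul, map_mul, hG p (hsub hp), zero_mul, add_zero, eval_linForm] at h
      exact (mul_eq_zero.mp h).resolve_left (hW' p hp)
  · rw [sup_le_iff, Submodule.map_le_iff_le_comap, Submodule.map_le_iff_le_comap]
    refine ⟨?_, fun B hB => ⟨?_, fun p hp => ?_⟩⟩
    · rintro A ⟨hA, hA0⟩
      refine ⟨?_, fun p hp => ?_⟩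
      · have := (isHomogeneous_linForm u).mul hA
        rwa [add_comm] at this
      · rw [LinearMap.mulLeft_apply, map_mul, eval_linForm]
        rcases hW p hp with h | h
        · rw [hA0 p h, mul_zero]
        · rw [h, zero_mul]
    · exact isHomogeneous_mul_of_mem_shiftForms (isHomogeneous_prod_linForm T v) hB
    · rw [LinearMap.mulLeft_apply, map_mul, hG p hp, zero_mul]

lemma map_mulLeft_inf_map_mulLeft {W : Set P2} {H G : MvPolynomial (Fin 3) ℂ} {n : ℕ}
    (hH : H.IsHomogeneous 1) (hHp : Prime H) (hG : G.IsHomogeneous n)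
    (hG0 : ∀ p ∈ W, eval p.rep G = 0) (hndvd : ¬H ∣ G) (d : ℕ) :
    (idealComp W d).map (LinearMap.mulLeft ℂ H) ⊓
      (shiftForms (d + 1) n).map (LinearMap.mulLeft ℂ G) =
    (shiftForms (d + 1) (n + 1)).map (LinearMap.mulLeft ℂ (H * G)) := by
  have hHG : (H * G).IsHomogeneous (n + 1) := by simpa [add_comm] using hH.mul hG
  apply le_antisymm
  · rintro _ ⟨⟨A, ⟨hA, -⟩, rfl⟩, B, hB, hAB⟩
    simp only [LinearMap.mulLeft_apply] at hAB ⊢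
    obtain ⟨C, rfl⟩ : H ∣ B := (hHp.dvd_or_dvd (hAB ▸ dvd_mul_right H A)).resolve_left hndvd
    have hHA : (H * A).IsHomogeneous (d + 1) := by simpa [add_comm] using hH.mul hA
    obtain ⟨C', hC', h⟩ := exists_homogeneousComponent_mul hHG C (d + 1)
    refine ⟨C', hC', ?_⟩
    rw [LinearMap.mulLeft_apply, ← h, ← homogeneousComponent_eq_self hHA, ← hAB]
    congr 1
    ring
  · rintro _ ⟨C, hC, rfl⟩
    refine ⟨⟨G * C, ⟨?_, fun p hp => ?_⟩, ?_⟩, H * C, mul_mem_shiftForms hH hC, ?_⟩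
    · rw [shiftForms_add_one] at hC
      exact isHomogeneous_mul_of_mem_shiftForms hG hC
    · rw [map_mul, hG0 p hp, zero_mul]
    · simp
    · simp only [LinearMap.mulLeft_apply]
      ring

lemma HF_eq (W : Set P2) (d : ℕ) :
    HF W d = ((d + 2).choose 2 : ℕ) - (Module.finrank ℂ (idealComp W d) : ℤ) := by
  rw [HF, finrank_homogeneousSubmodule_fin_three]

lemma HF_add_points_on_line {ι : Type*} [DecidableEq ι] {W W' : Set P2} {u : Fin 3 → ℂ}
    {v : ι → Fin 3 → ℂ} {q : ι → P2} {T : Finset ι} (hcard : T.Nontrivial) (hu0 : u ≠ 0)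
    (hsub : W' ⊆ W) (hW' : ∀ p ∈ W', u ⬝ᵥ p.rep ≠ 0)
    (hW : ∀ p ∈ W, p ∈ W' ∨ u ⬝ᵥ p.rep = 0) (hT : ∀ p ∈ W, ∃ i ∈ T, v i ⬝ᵥ p.rep = 0)
    (hli : ∀ i ∈ T, LinearIndependent ℂ ![u, v i]) (hq : ∀ i ∈ T, q i ∈ W)
    (hu : ∀ i ∈ T, u ⬝ᵥ (q i).rep = 0) (hv : ∀ i ∈ T, v i ⬝ᵥ (q i).rep = 0)
    (hne : ∀ i ∈ T, ∀ j ∈ T, i ≠ j → v i ⬝ᵥ (q j).rep ≠ 0) (d : ℕ) :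
    HF W (d + 1) = HF W' d + (d + 2) - (d + 2 - T.card : ℕ) := by
  have hndvd : ¬linForm u ∣ ∏ i ∈ T, linForm (v i) := by
    intro h
    obtain ⟨i, hi, h⟩ := (prime_linForm hu0).exists_mem_finset_dvd h
    obtain ⟨j, hj, hji⟩ := hcard.exists_ne i
    apply hne i hi j hj hji.symm
    obtain ⟨c, hc⟩ := h
    rw [← eval_linForm, hc, map_mul, eval_linForm, hu j hj, zero_mul]
  have hG : ∀ p ∈ W', eval p.rep (∏ i ∈ T, linForm (v i)) = 0 := by
    intro p hp
    obtain ⟨i, hi, h⟩ := hT p (hsub hp)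
    rw [map_prod]
    exact Finset.prod_eq_zero hi (by rw [eval_linForm, h])
  have hG0 : ∏ i ∈ T, linForm (v i) ≠ 0 := fun h => hndvd (h ▸ dvd_zero _)
  have key := Submodule.finrank_sup_add_finrank_inf_eq
    ((idealComp W' d).map (LinearMap.mulLeft ℂ (linForm u)))
    ((shiftForms (d + 1) T.card).map (LinearMap.mulLeft ℂ (∏ i ∈ T, linForm (v i))))
  rw [← idealComp_eq_sup hsub hW' hW hT hli hq hu hv hne,
    map_mulLeft_inf_map_mulLeft (isHomogeneous_linForm u) (prime_linForm hu0)
      (isHomogeneous_prod_linForm T v) hG hndvd,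
    finrank_map_mulLeft (mul_ne_zero (linForm_ne_zero hu0) hG0),
    finrank_map_mulLeft (linForm_ne_zero hu0), finrank_map_mulLeft hG0,
    finrank_shiftForms, finrank_shiftForms] at key
  have h1 : (d + 1 + 2).choose 2 = (d + 2) + (d + 2).choose 2 := by
    rw [show d + 1 + 2 = (d + 2) + 1 by ring, Nat.choose_succ_succ' (d + 2) 1, Nat.choose_one_right]
  have h2 : (d + 1 + 2 - T.card).choose 2 =
      (d + 2 - T.card) + (d + 1 + 2 - (T.card + 1)).choose 2 := by
    rw [show d + 1 + 2 - (T.card + 1) = d + 2 - T.card by omega]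
    by_cases h : T.card ≤ d + 2
    · rw [show d + 1 + 2 - T.card = (d + 2 - T.card) + 1 by omega,
        Nat.choose_succ_succ' _ 1, Nat.choose_one_right]
    · simp [show d + 1 + 2 - T.card = 0 by omega, show d + 2 - T.card = 0 by omega]
  rw [HF_eq, HF_eq]
  omega

lemma HF_empty (d : ℕ) : HF ∅ d = 0 := by
  have h : idealComp ∅ d = homogeneousSubmodule (Fin 3) ℂ d :=
    inf_eq_left.mpr fun F _ p hp => hp.elim
  rw [HF, h, sub_self]

lemma HF_zero_of_nonempty {W : Set P2} (hW : W.Nonempty) : HF W 0 = 1 := by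
  obtain ⟨p, hp⟩ := hW
  have h : idealComp W 0 = ⊥ := by
    rw [eq_bot_iff]
    rintro F ⟨hF, hF0⟩
    obtain ⟨c, rfl⟩ : ∃ c, F = C c :=
      ⟨_, totalDegree_eq_zero_iff_eq_C.mp (Nat.le_zero.mp hF.totalDegree_le)⟩
    simpa using hF0 p hp
  rw [HF_eq, h, finrank_bot]
  simp

lemma exists_dotProduct_rep_eq_zero (u v : Fin 3 → ℂ) :
    ∃ p : P2, u ⬝ᵥ p.rep = 0 ∧ v ⬝ᵥ p.rep = 0 := by
  obtain ⟨x, hx, h⟩ := Matrix.exists_mulVec_eq_zero_iff.mpr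
    (Matrix.det_eq_zero_of_row_eq_zero (A := Matrix.of ![u, v, 0]) 2 (by simp))
  obtain ⟨c, hc⟩ := Projectivization.exists_smul_eq_mk_rep ℂ x hx
  refine ⟨Projectivization.mk ℂ x hx, ?_⟩
  have h0 := congrFun h 0
  have h1 := congrFun h 1
  simp only [Matrix.mulVec, Matrix.of_apply, Matrix.cons_val_zero, Matrix.cons_val_one,
    Pi.zero_apply] at h0 h1
  simp [← hc, dotProduct_smul, h0, h1]

lemma MeetsProperly.exists_coefficients {r : ℕ} {m : Fin r → Set P2} (hm : MeetsProperly m) :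
    ∃ a : Fin r → Fin 3 → ℂ, (∀ i, a i ≠ 0) ∧ (∀ i p, p ∈ m i ↔ a i ⬝ᵥ p.rep = 0) ∧
      ∀ i j, i ≠ j → LinearIndependent ℂ ![a i, a j] := by
  choose a ha hma using hm.1
  have hmem : ∀ i p, p ∈ m i ↔ a i ⬝ᵥ p.rep = 0 := by
    intro i p
    rw [hma i]
    rfl
  refine ⟨a, ha, hmem, fun i j hij => ?_⟩
  rw [LinearIndependent.pair_iff' (ha i)]
  intro c hc
  have hc0 : c ≠ 0 := by
    rintro rfl
    exact ha j (by rw [← hc, zero_smul])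
  apply hij
  apply hm.2.1
  ext p
  rw [hmem, hmem, ← hc, smul_dotProduct, smul_eq_zero, or_iff_right hc0]

/-- The points lying on one of the lines `m_s, …, m_{s+k-1}` and on an earlier line. -/
def starTail {r : ℕ} (m : Fin r → Set P2) (s k : ℕ) : Set P2 :=
  {p | ∃ i j : Fin r, i < j ∧ s ≤ (j : ℕ) ∧ (j : ℕ) < s + k ∧ p ∈ m i ∧ p ∈ m j}

lemma starConfig_diff_eq_starTail {s t : ℕ} {m : Fin (s + t) → Set P2} (hm : MeetsProperly m) :
    starConfig m \ starConfig (fun i : Fin s => m (Fin.castAdd t i)) = starTail m s t := by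
  ext p
  constructor
  · rintro ⟨⟨i, j, hij, hi, hj⟩, hp⟩
    wlog h : i < j generalizing i j
    · exact this j i hij.symm hj hi (lt_of_le_of_ne (not_lt.mp h) hij.symm)
    refine ⟨i, j, h, ?_, j.2, hi, hj⟩
    by_contra hjs
    have hjs : (j : ℕ) < s := not_le.mp hjs
    have his : (i : ℕ) < s := lt_trans h hjs
    exact hp ⟨⟨i, his⟩, ⟨j, hjs⟩, fun h => hij (Fin.ext (Fin.mk.inj h)), hi, hj⟩
  · rintro ⟨i, j, hij, hs, -, hi, hj⟩
    refine ⟨⟨i, j, hij.ne, hi, hj⟩, ?_⟩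
    rintro ⟨i', j', hij', hi', hj'⟩
    have hi's := i'.2
    have hj's := j'.2
    rcases hm.2.2 p _ _ _ hi' hj' hj with h | h | h
    · exact hij' (Fin.castAdd_injective s t h)
    · have := congrArg Fin.val h
      simp only [Fin.val_castAdd] at this
      omega
    · have := congrArg Fin.val h
      simp only [Fin.val_castAdd] at this
      omega

lemma starTail_zero {r : ℕ} (m : Fin r → Set P2) (s : ℕ) : starTail m s 0 = ∅ := by
  rw [Set.eq_empty_iff_forall_notMem]
  rintro p ⟨i, j, -, h, h', -⟩
  omega

lemma starTail_nonempty {r : ℕ} {m : Fin r → Set P2} (hm : MeetsProperly m) {s k : ℕ}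
    (hs : 1 ≤ s) (hk : 1 ≤ k) (hr : s + k ≤ r) : (starTail m s k).Nonempty := by
  obtain ⟨a, -, hma, -⟩ := hm.exists_coefficients
  obtain ⟨p, h0, h1⟩ := exists_dotProduct_rep_eq_zero (a ⟨0, by omega⟩) (a ⟨s, by omega⟩)
  exact ⟨p, ⟨0, by omega⟩, ⟨s, by omega⟩, Fin.mk_lt_mk.mpr (by omega), le_rfl,
    by simpa using (by omega : 0 < k), (hma _ _).mpr h0, (hma _ _).mpr h1⟩

lemma HF_starTail_succ {r : ℕ} {m : Fin r → Set P2} (hm : MeetsProperly m) {s k : ℕ}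
    (hs : 2 ≤ s) (hr : s + k < r) (d : ℕ) :
    HF (starTail m s (k + 1)) (d + 1) =
      HF (starTail m s k) d + (d + 2) - (d + 2 - (s + k) : ℕ) := by
  obtain ⟨a, ha, hma, hli⟩ := hm.exists_coefficients
  set J : Fin r := ⟨s + k, hr⟩ with hJ
  choose q hqJ hq using fun i => exists_dotProduct_rep_eq_zero (a J) (a i)
  have hcard : (Finset.Iio J).card = s + k := by simp [hJ]
  have key := HF_add_points_on_line (W := starTail m s (k + 1)) (W' := starTail m s k)
    (u := a J) (v := a) (q := q) (T := Finset.Iio J)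
    (Finset.one_lt_card_iff_nontrivial.mp (by omega)) (ha J) ?_ ?_ ?_ ?_ ?_ ?_ ?_ ?_ ?_ d
  · rwa [hcard] at key
  · rintro p ⟨i, j, hij, hsj, hj, hp⟩
    exact ⟨i, j, hij, hsj, by omega, hp⟩
  · rintro p ⟨i, j, hij, hsj, hj, hpi, hpj⟩ hpJ
    have hjJ : j < J := Fin.lt_def.mpr hj
    rcases hm.2.2 p i j J hpi hpj ((hma _ _).mpr hpJ) with h | h | h
    · exact hij.ne h
    · exact (hij.trans hjJ).ne h
    · exact hjJ.ne h
  · rintro p ⟨i, j, hij, hsj, hj, hpi, hpj⟩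
    rcases Nat.lt_succ_iff_lt_or_eq.mp hj with h | h
    · exact Or.inl ⟨i, j, hij, hsj, h, hpi, hpj⟩
    · exact Or.inr ((hma _ _).mp ((Fin.ext h : j = J) ▸ hpj))
  · rintro p ⟨i, j, hij, hsj, hj, hpi, hpj⟩
    have hjJ : j ≤ J := Fin.le_def.mpr (Nat.lt_succ_iff.mp hj)
    exact ⟨i, Finset.mem_Iio.mpr (hij.trans_le hjJ), (hma _ _).mp hpi⟩
  · exact fun i hi => hli _ _ (Finset.mem_Iio.mp hi).ne'
  · exact fun i hi => ⟨i, J, Finset.mem_Iio.mp hi, Nat.le_add_right _ _, Nat.lt_succ_self _,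
      (hma _ _).mpr (hq i), (hma _ _).mpr (hqJ i)⟩
  · exact fun i _ => hqJ i
  · exact fun i _ => hq i
  · intro i hi j hj hij h
    rcases hm.2.2 (q j) i j J ((hma _ _).mpr h) ((hma _ _).mpr (hq j)) ((hma _ _).mpr (hqJ j))
      with h | h | h
    · exact hij h
    · exact (Finset.mem_Iio.mp hi).ne h
    · exact (Finset.mem_Iio.mp hj).ne h

lemma hvec_starTail {r : ℕ} {m : Fin r → Set P2} (hm : MeetsProperly m) {s : ℕ} (hs : 2 ≤ s)
    (k : ℕ) (hr : s + k ≤ r) (d : ℕ) :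
    hvec (starTail m s k) d =
      if d + 1 < k then (d : ℤ) + 1 else if d + 1 < s + k then (k : ℤ) else 0 := by
  induction k generalizing d with
  | zero =>
    rw [starTail_zero]
    cases d <;> simp [hvec, HF_empty]
  | succ k ih =>
    have h0 := HF_zero_of_nonempty (starTail_nonempty hm (by omega) (Nat.le_add_left 1 k) hr)
    have hstep := HF_starTail_succ hm hs (by omega : s + k < r)
    match d with
    | 0 =>
      rw [hvec, h0]
      split_ifs <;> push_cast <;> omega
    | 1 =>
      have h := ih (by omega) 0
      rw [hvec] at h
      change HF _ (0 + 1) - HF _ 0 = _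
      rw [hstep, h0, h]
      split_ifs <;> push_cast <;> omega
    | d + 2 =>
      have h := ih (by omega) (d + 1)
      rw [hvec] at h ⊢
      rw [hstep, hstep]
      push_cast at h ⊢
      split_ifs at h ⊢ <;> omega

/-- **The h-vector of the difference of two nested star configurations.**
Let `s ≥ 2`, `t ≥ 1`, and let `m₁,…,m_{s+t}` be distinct lines meeting properly.  Let
`X = 𝕊(m₁,…,m_{s+t})` and `Y = 𝕊(m₁,…,m_s) ⊆ X`.  Then the h-vector of `X ∖ Y` is
`(1, 2, …, t−1, t, t, …, t)` with `s+1` entries equal to `t`: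
`h(d) = d+1` for `0 ≤ d ≤ t−2`, `h(d) = t` for `t−1 ≤ d ≤ t+s−2`, and `h(d) = 0` for
`d ≥ t+s−1`. -/
theorem hvector_of_star_difference
    (s t : ℕ) (hs : 2 ≤ s) (ht : 1 ≤ t)
    (m : Fin (s + t) → Set P2) (hm : MeetsProperly m) :
    (∀ d : ℕ, d ≤ t - 2 →
      hvec (starConfig m \ starConfig (fun i : Fin s => m (Fin.castAdd t i))) d = (d : ℤ) + 1) ∧
    (∀ d : ℕ, t - 1 ≤ d → d ≤ t + s - 2 →
      hvec (starConfig m \ starConfig (fun i : Fin s => m (Fin.castAdd t i))) d = (t : ℤ)) ∧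
    (∀ d : ℕ, t + s - 1 ≤ d →
      hvec (starConfig m \ starConfig (fun i : Fin s => m (Fin.castAdd t i))) d = 0) := by
  rw [starConfig_diff_eq_starTail hm]
  have h := hvec_starTail hm hs t le_rfl
  refine ⟨fun d hd => ?_, fun d hd hd' => ?_, fun d hd => ?_⟩ <;>
    rw [h] <;> split_ifs <;> omega
end
end
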